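/- If q ∈ QC satisfies q|_{M_{τ_0}^0(QC)} = 0 for τ_0 = 1 (respectively τ_0 = −1), and p ∈ PC is continuous on T \ {τ_0}, then the product pq belongs to QC. -/

import Mathlib

open MeasureTheory Real Filter Topology

noncomputable section

/-- The `n`-th Fourier coefficient of `f : ℝ → ℂ` (representing `x ↦ f(e^{ix})`). -/
def fourierCoef (f : ℝ → ℂ) (n : ℤ) : ℂ :=
  (1 / (2 * π)) * ∫ x in (0 : ℝ)..(2 * π), f x * Complex.exp (-(Complex.I * n * x))

/-- `L^∞(T)`, modeled as bounded measurable `2π`-periodic functions `ℝ → ℂ`. -/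
def LinfT : Set (ℝ → ℂ) :=
  {f | Function.Periodic f (2 * π) ∧ Measurable f ∧ ∃ C, ∀ x, ‖f x‖ ≤ C}

/-- `C(T)`: continuous `2π`-periodic functions. -/
def CtsT : Set (ℝ → ℂ) := {f | Function.Periodic f (2 * π) ∧ Continuous f}

/-- The Hardy space `H^∞`: bounded functions whose negative Fourier coefficients vanish. -/
def HinfT : Set (ℝ → ℂ) := {f ∈ LinfT | ∀ n : ℤ, n < 0 → fourierCoef f n = 0}

/-- The conjugate Hardy space: bounded functions whose positive Fourier coefficients vanish. -/
def HinfBarT : Set (ℝ → ℂ) := {f ∈ LinfT | ∀ n : ℤ, 0 < n → fourierCoef f n = 0}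

/-- The quasicontinuous functions `QC = (C + H^∞) ∩ (C + conj(H^∞))`. -/
def QCset : Set (ℝ → ℂ) :=
  {f | (∃ c ∈ CtsT, ∃ h ∈ HinfT, f = c + h) ∧ (∃ c ∈ CtsT, ∃ h ∈ HinfBarT, f = c + h)}

/-- The flip `q̃(t) = q(1/t)`, i.e. `q̃(e^{ix}) = q(e^{-ix})`. -/
def flipF (f : ℝ → ℂ) : ℝ → ℂ := fun x => f (-x)

/-- The even quasicontinuous functions `Q̃C = {q ∈ QC : q = q̃}`. -/
def tQCset : Set (ℝ → ℂ) := {f ∈ QCset | flipF f = f}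

/-- The even continuous functions `C̃(T)`. -/
def evContT : Set (ℝ → ℂ) := {f ∈ CtsT | flipF f = f}

/-- The piecewise continuous functions `PC`: `2π`-periodic functions having one-sided
limits at every point. -/
def PCset : Set (ℝ → ℂ) :=
  {p | Function.Periodic p (2 * π) ∧
    ∀ θ : ℝ, (∃ l : ℂ, Tendsto p (𝓝[>] θ) (𝓝 l)) ∧ (∃ l : ℂ, Tendsto p (𝓝[<] θ) (𝓝 l))}

/-- `ξ` is a character (multiplicative linear functional of norm `1`) of the subalgebra of
`L^∞(T)` whose underlying set is `S`; only the values of `ξ` on `S` are relevant. -/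
def IsChar (S : Set (ℝ → ℂ)) (ξ : (ℝ → ℂ) → ℂ) : Prop :=
  (∀ p ∈ S, ∀ q ∈ S, ξ (p + q) = ξ p + ξ q) ∧
  (∀ p ∈ S, ∀ q ∈ S, ξ (p * q) = ξ p * ξ q) ∧
  (∀ (c : ℂ), ∀ q ∈ S, ξ (c • q) = c * ξ q) ∧
  ξ 1 = 1 ∧
  (∀ q ∈ S, ∀ C : ℝ, (∀ x, ‖q x‖ ≤ C) → ‖ξ q‖ ≤ C)

/-- The moving average `δ_{λ,τ}(a) = (λ/2π) ∫_{θ-π/λ}^{θ+π/λ} a(e^{ix}) dx`, `τ = e^{iθ}`. -/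
def movAvg (a : ℝ → ℂ) (lam θ : ℝ) : ℂ :=
  (lam / (2 * π)) * ∫ x in (θ - π / lam)..(θ + π / lam), a x

/-- `ξ ∈ M_τ^0(S)` (`τ = e^{iθ}`): `ξ` is a character of (the algebra with underlying set) `S`
lying in the weak-* closure of the moving-average functionals `{δ_{λ,τ} : λ ∈ [1,∞)}`. -/
def InM0 (S : Set (ℝ → ℂ)) (θ : ℝ) (ξ : (ℝ → ℂ) → ℂ) : Prop :=
  IsChar S ξ ∧
  ∀ qs : List (ℝ → ℂ), (∀ q ∈ qs, q ∈ S) → ∀ ε : ℝ, 0 < ε →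
    ∃ lam : ℝ, 1 ≤ lam ∧ ∀ q ∈ qs, ‖ξ q - movAvg q lam θ‖ < ε

/-- `ξ ∈ M_τ(S)` (`τ = e^{iθ}`): the fiber condition `ξ(f) = f(τ)` for all continuous `f`
belonging to `S`. -/
def InFiber (S : Set (ℝ → ℂ)) (θ : ℝ) (ξ : (ℝ → ℂ) → ℂ) : Prop :=
  IsChar S ξ ∧ ∀ f ∈ CtsT ∩ S, ξ f = f θ

/-- `ξ ∈ M_τ^+(QC)`: `ξ(f) = 0` whenever `limsup_{t→τ+0}|f(t)| = 0`, `f ∈ QC`. -/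
def InMplus (θ : ℝ) (ξ : (ℝ → ℂ) → ℂ) : Prop :=
  IsChar QCset ξ ∧
  ∀ f ∈ QCset, Filter.limsup (fun x => ‖f x‖) (𝓝[>] θ) = 0 → ξ f = 0

/-- `ξ ∈ M_τ^-(QC)`: `ξ(f) = 0` whenever `limsup_{t→τ-0}|f(t)| = 0`, `f ∈ QC`. -/
def InMminus (θ : ℝ) (ξ : (ℝ → ℂ) → ℂ) : Prop :=
  IsChar QCset ξ ∧
  ∀ f ∈ QCset, Filter.limsup (fun x => ‖f x‖) (𝓝[<] θ) = 0 → ξ f = 0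

/-- The conjugate character `ξ'(q) = ξ(q̃)`. -/
def conjChar (ξ : (ℝ → ℂ) → ℂ) : (ℝ → ℂ) → ℂ := fun q => ξ (flipF q)


/-- Normalized Lebesgue measure on the circle. -/
def nu : Measure ℝ := ENNReal.ofReal (1 / (2 * π)) • volume.restrict (Set.Ioc 0 (2 * π))

/-- Lebesgue measure on the unit interval. -/
def rho : Measure ℝ := volume.restrict (Set.Ioc 0 1)

/-- The coordinate function. -/
def zz (x : ℝ) : ℂ := Complex.exp (Complex.I * x)

/-- bounded measurable -/
def BM (f : ℝ → ℂ) : Prop := Measurable f ∧ ∃ C, ∀ x, ‖f x‖ ≤ C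

lemma two_pi_pos' : (0 : ℝ) < 2 * π := by positivity

instance nu_prob : IsProbabilityMeasure nu := by
  constructor
  simp only [nu, Measure.smul_apply, MeasurableSet.univ, Measure.restrict_apply, Set.univ_inter,
    Real.volume_Ioc, smul_eq_mul, sub_zero]
  rw [← ENNReal.ofReal_mul (by positivity)]
  rw [one_div, inv_mul_cancel₀ two_pi_pos'.ne', ENNReal.ofReal_one]

instance rho_prob : IsProbabilityMeasure rho := by
  constructor
  simp [rho]

lemma nu_int {E : Type*} [NormedAddCommGroup E] [NormedSpace ℝ E] (f : ℝ → E) :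
    ∫ x, f x ∂nu = (1 / (2 * π)) • ∫ x in (0 : ℝ)..(2 * π), f x := by
  rw [nu, integral_smul_measure, intervalIntegral.integral_of_le two_pi_pos'.le,
    ENNReal.toReal_ofReal (by positivity)]

lemma rho_int {E : Type*} [NormedAddCommGroup E] [NormedSpace ℝ E] (f : ℝ → E) :
    ∫ x, f x ∂rho = ∫ x in (0 : ℝ)..1, f x := by
  rw [rho, intervalIntegral.integral_of_le zero_le_one]

lemma nu_shift {E : Type*} [NormedAddCommGroup E] [NormedSpace ℝ E] {f : ℝ → E}
    (hf : Function.Periodic f (2 * π)) (t : ℝ) : ∫ x, f (x + t) ∂nu = ∫ x, f x ∂nu := by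
  rw [nu_int, nu_int]
  congr 1
  rw [intervalIntegral.integral_comp_add_right (fun x => f x) t]
  rw [zero_add, add_comm (2 * π) t]
  simpa using hf.intervalIntegral_add_eq t 0

lemma nu_int_sym {E : Type*} [NormedAddCommGroup E] [NormedSpace ℝ E] {f : ℝ → E}
    (hf : Function.Periodic f (2 * π)) :
    ∫ x, f x ∂nu = (1 / (2 * π)) • ∫ x in (-π)..π, f x := by
  rw [nu_int]
  have := hf.intervalIntegral_add_eq 0 (-π)
  rw [zero_add, show -π + 2 * π = π by ring] at this
  rw [this]

lemma zz_norm (x : ℝ) : ‖zz x‖ = 1 := by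
  rw [zz, mul_comm]; exact Complex.norm_exp_ofReal_mul_I x

lemma zz_ne (x : ℝ) : zz x ≠ 0 := Complex.exp_ne_zero _

lemma zz_cont : Continuous zz := by unfold zz; fun_prop

lemma zz_add (x y : ℝ) : zz (x + y) = zz x * zz y := by
  simp only [zz, ← Complex.exp_add]; push_cast; ring_nf

lemma zz_per : Function.Periodic zz (2 * π) := by
  intro x
  have : zz (2 * π) = 1 := by
    rw [zz]; push_cast
    rw [show Complex.I * (2 * (π : ℂ)) = 2 * π * Complex.I by ring, Complex.exp_two_pi_mul_I]
  rw [zz_add, this, mul_one]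

lemma zz_conj (x : ℝ) : (starRingEnd ℂ) (zz x) = (zz x)⁻¹ := by
  rw [zz, ← Complex.exp_conj, ← Complex.exp_neg]; simp

lemma zz_eq (x : ℝ) : zz x = Complex.cos x + Complex.sin x * Complex.I := by
  rw [zz, mul_comm, Complex.exp_mul_I]

lemma zz_inv_eq (x : ℝ) : (zz x)⁻¹ = Complex.cos x - Complex.sin x * Complex.I := by
  rw [zz, ← Complex.exp_neg, show -(Complex.I * (x : ℂ)) = (-x : ℂ) * Complex.I by ring,
    Complex.exp_mul_I, Complex.cos_neg, Complex.sin_neg]; ring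

lemma BM.add {f g} (hf : BM f) (hg : BM g) : BM (fun x => f x + g x) := by
  obtain ⟨a, C, b⟩ := hf; obtain ⟨c, D, d⟩ := hg
  exact ⟨a.add c, C + D, fun x => (norm_add_le _ _).trans (add_le_add (b x) (d x))⟩

lemma BM.sub {f g} (hf : BM f) (hg : BM g) : BM (fun x => f x - g x) := by
  obtain ⟨a, C, b⟩ := hf; obtain ⟨c, D, d⟩ := hg
  exact ⟨a.sub c, C + D, fun x => (norm_sub_le _ _).trans (add_le_add (b x) (d x))⟩

lemma BM.mul {f g} (hf : BM f) (hg : BM g) : BM (fun x => f x * g x) := by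
  obtain ⟨a, C, b⟩ := hf; obtain ⟨c, D, d⟩ := hg
  exact ⟨a.mul c, C * D, fun x => by
    rw [norm_mul]
    exact mul_le_mul (b x) (d x) (norm_nonneg _) ((norm_nonneg _).trans (b x))⟩

lemma BM.conj {f} (hf : BM f) : BM (fun x => (starRingEnd ℂ) (f x)) := by
  obtain ⟨a, C, b⟩ := hf
  exact ⟨Complex.continuous_conj.measurable.comp a, C, fun x => by simpa using b x⟩

lemma BM.const (c : ℂ) : BM (fun _ => c) := ⟨measurable_const, ‖c‖, fun _ => le_rfl⟩

lemma BM.zpow (m : ℕ) : BM (fun x => zz x ^ m) :=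
  ⟨(zz_cont.pow m).measurable, 1, fun x => by simp [zz_norm]⟩

lemma BM.shift {f} (hf : BM f) (t : ℝ) : BM (fun x => f (x + t)) := by
  obtain ⟨a, C, b⟩ := hf
  exact ⟨a.comp (measurable_add_const t), C, fun x => b _⟩

lemma BM.int {f} (hf : BM f) (μ : Measure ℝ) [IsFiniteMeasure μ] : Integrable f μ := by
  obtain ⟨a, C, b⟩ := hf
  exact Integrable.of_bound a.aestronglyMeasurable C (Eventually.of_forall b)

lemma BM.ii {f} (hf : BM f) (a b : ℝ) : IntervalIntegrable f volume a b := by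
  rw [intervalIntegrable_iff]
  have : IsFiniteMeasure (volume.restrict (Set.uIoc a b)) := by
    constructor; simp [Set.uIoc]
  exact hf.int _

lemma LinfT_iff {f : ℝ → ℂ} : f ∈ LinfT ↔ Function.Periodic f (2 * π) ∧ BM f := Iff.rfl

lemma cts_bdd {c : ℝ → ℂ} (hc : c ∈ CtsT) : BM c := by
  obtain ⟨hp, hc⟩ := hc
  refine ⟨hc.measurable, ?_⟩
  obtain ⟨C, hC⟩ := (isCompact_Icc (a := (0 : ℝ)) (b := 2 * π)).exists_bound_of_continuousOn
    hc.continuousOn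
  refine ⟨C, fun x => ?_⟩
  obtain ⟨y, hy, hxy⟩ := hp.exists_mem_Ico₀ two_pi_pos' x
  rw [hxy]; exact hC y ⟨hy.1, hy.2.le⟩

/-- Reformulation of the Hardy space. -/
def Hs (f : ℝ → ℂ) : Prop :=
  Function.Periodic f (2 * π) ∧ BM f ∧ ∀ m : ℕ, 1 ≤ m → ∫ x, f x * zz x ^ m ∂nu = 0

lemma fc_neg (f : ℝ → ℂ) (m : ℕ) : fourierCoef f (-(m : ℤ)) = ∫ x, f x * zz x ^ m ∂nu := by
  rw [nu_int, fourierCoef, Complex.real_smul]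
  congr 1
  · push_cast; rfl
  · congr 1; ext x; rw [zz, ← Complex.exp_nat_mul]; push_cast; ring_nf

lemma mem_Hinf {f : ℝ → ℂ} : f ∈ HinfT ↔ Hs f := by
  constructor
  · rintro ⟨⟨hp, hb⟩, h⟩
    refine ⟨hp, hb, fun m hm => ?_⟩
    rw [← fc_neg]; exact h _ (by omega)
  · rintro ⟨hp, hb, h⟩
    refine ⟨⟨hp, hb⟩, fun n hn => ?_⟩
    obtain ⟨m, rfl⟩ : ∃ m : ℕ, n = -(m : ℤ) := ⟨n.natAbs, by omega⟩
    rw [fc_neg]; exact h _ (by omega)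

lemma conj_mem_bar {f : ℝ → ℂ} (hf : Hs (fun x => (starRingEnd ℂ) (f x))) : f ∈ HinfBarT := by
  obtain ⟨hp, hb, h⟩ := hf
  refine ⟨⟨fun x => ?_, by have h2 := hb.conj; simp only [Complex.conj_conj] at h2; exact h2⟩, fun n hn => ?_⟩
  · have := congrArg (starRingEnd ℂ) (hp x); simpa using this
  · obtain ⟨m, rfl⟩ : ∃ m : ℕ, n = (m : ℤ) := ⟨n.natAbs, by omega⟩
    have h1 := congrArg (starRingEnd ℂ) (h m (by omega))
    rw [← integral_conj, nu_int, Complex.real_smul] at h1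
    rw [fourierCoef]
    rw [map_zero] at h1
    rw [← h1]
    congr 1
    · push_cast; rfl
    · congr 1; ext x
      simp only [map_mul, map_pow, Complex.conj_conj, zz_conj]
      rw [zz, ← Complex.exp_neg, ← Complex.exp_nat_mul]; push_cast; ring_nf

lemma bar_conj {f : ℝ → ℂ} (hf : f ∈ HinfBarT) : Hs (fun x => (starRingEnd ℂ) (f x)) := by
  obtain ⟨⟨hp, hb⟩, h⟩ := hf
  refine ⟨fun x => by simp [hp x], BM.conj hb, fun m hm => ?_⟩
  have h1 := congrArg (starRingEnd ℂ) (h m (by omega))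
  rw [fourierCoef, map_zero, map_mul] at h1
  rw [nu_int, Complex.real_smul, ← h1]
  congr 1
  · rw [show (1 / (2 * (π:ℂ))) = ((1 / (2 * π) : ℝ) : ℂ) by push_cast; rfl, Complex.conj_ofReal]
  · rw [intervalIntegral.integral_of_le two_pi_pos'.le, intervalIntegral.integral_of_le two_pi_pos'.le,
      ← integral_conj]
    congr 1; ext x
    simp only [map_mul]
    congr 1
    rw [zz, ← Complex.exp_nat_mul, ← Complex.exp_conj]; simp; ring_nf

lemma Hs.bar_flip {f : ℝ → ℂ} (hf : Hs f) : (fun x => (starRingEnd ℂ) (f x)) ∈ HinfBarT :=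
  conj_mem_bar (by simpa using hf)

/-- C + H^∞ -/
def CH (f : ℝ → ℂ) : Prop := ∃ c ∈ CtsT, ∃ h, Hs h ∧ f = c + h

lemma CtsT.conj {c : ℝ → ℂ} (hc : c ∈ CtsT) : (fun x => (starRingEnd ℂ) (c x)) ∈ CtsT :=
  ⟨fun x => by simp [hc.1 x], Complex.continuous_conj.comp hc.2⟩

lemma QC_iff {f : ℝ → ℂ} : f ∈ QCset ↔ CH f ∧ CH (fun x => (starRingEnd ℂ) (f x)) := by
  constructor
  · rintro ⟨⟨c, hc, h, hh, e⟩, ⟨c', hc', h', hh', e'⟩⟩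
    refine ⟨⟨c, hc, h, mem_Hinf.1 hh, e⟩, ⟨_, CtsT.conj hc', _, bar_conj hh', ?_⟩⟩
    ext x; simp [e']
  · rintro ⟨⟨c, hc, h, hh, e⟩, ⟨c', hc', h', hh', e'⟩⟩
    refine ⟨⟨c, hc, h, mem_Hinf.2 hh, e⟩, ⟨_, CtsT.conj hc', _, hh'.bar_flip, ?_⟩⟩
    ext x
    have := congrArg (starRingEnd ℂ) (congrFun e' x)
    simpa using this

lemma CH.bm {f} (hf : CH f) : BM f := by
  obtain ⟨c, hc, h, hh, rfl⟩ := hf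
  exact (cts_bdd hc).add hh.2.1

lemma CH.per {f} (hf : CH f) : Function.Periodic f (2 * π) := by
  obtain ⟨c, hc, h, hh, rfl⟩ := hf
  exact hc.1.add hh.1

lemma Hs.add {f g} (hf : Hs f) (hg : Hs g) : Hs (fun x => f x + g x) := by
  refine ⟨hf.1.add hg.1, hf.2.1.add hg.2.1, fun m hm => ?_⟩
  simp only [add_mul]
  rw [integral_add ((hf.2.1.mul (BM.zpow m)).int _) ((hg.2.1.mul (BM.zpow m)).int _),
    hf.2.2 m hm, hg.2.2 m hm, add_zero]

lemma Hs.smul {f} (hf : Hs f) (a : ℂ) : Hs (fun x => a * f x) := by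
  refine ⟨fun x => by simp [hf.1 x], (BM.const a).mul hf.2.1, fun m hm => ?_⟩
  simp only [mul_assoc]
  rw [integral_const_mul, hf.2.2 m hm, mul_zero]

lemma Hs.sub {f g} (hf : Hs f) (hg : Hs g) : Hs (fun x => f x - g x) := by
  have := hf.add (hg.smul (-1))
  simpa [sub_eq_add_neg] using this

lemma CtsT.add {f g : ℝ → ℂ} (hf : f ∈ CtsT) (hg : g ∈ CtsT) : (fun x => f x + g x) ∈ CtsT :=
  ⟨hf.1.add hg.1, hf.2.add hg.2⟩
lemma CtsT.sub {f g : ℝ → ℂ} (hf : f ∈ CtsT) (hg : g ∈ CtsT) : (fun x => f x - g x) ∈ CtsT :=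
  ⟨hf.1.sub hg.1, hf.2.sub hg.2⟩
lemma CtsT.mul {f g : ℝ → ℂ} (hf : f ∈ CtsT) (hg : g ∈ CtsT) : (fun x => f x * g x) ∈ CtsT :=
  ⟨hf.1.mul hg.1, hf.2.mul hg.2⟩
lemma CtsT.const (a : ℂ) : (fun _ => a) ∈ CtsT := ⟨fun _ => rfl, continuous_const⟩

lemma CH.add {f g} (hf : CH f) (hg : CH g) : CH (fun x => f x + g x) := by
  obtain ⟨c, hc, h, hh, rfl⟩ := hf
  obtain ⟨c', hc', h', hh', rfl⟩ := hg
  exact ⟨_, CtsT.add hc hc', _, hh.add hh', by ext x; simp; ring⟩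

lemma CH.smul {f} (hf : CH f) (a : ℂ) : CH (fun x => a * f x) := by
  obtain ⟨c, hc, h, hh, rfl⟩ := hf
  exact ⟨_, CtsT.mul (CtsT.const a) hc, _, hh.smul a, by ext x; simp; ring⟩

lemma CH.sub {f g} (hf : CH f) (hg : CH g) : CH (fun x => f x - g x) := by
  have := hf.add (hg.smul (-1))
  simpa [sub_eq_add_neg] using this

lemma nu_zz (m : ℕ) (hm : 1 ≤ m) : ∫ x, zz x ^ m ∂nu = 0 := by
  rw [nu_int]
  have : ∀ x : ℝ, zz x ^ m = Complex.exp ((Complex.I * m) * x) := by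
    intro x; rw [zz, ← Complex.exp_nat_mul]; ring_nf
  simp only [this]
  rw [integral_exp_mul_complex (by simp; omega)]
  have h2 : Complex.exp (Complex.I * m * ((2 * π : ℝ) : ℂ)) = 1 := by
    rw [← this, ← zero_add (2 * π), zz_per 0, zz]; simp
  rw [h2]; simp

lemma Hs.const (a : ℂ) : Hs (fun _ => a) := by
  refine ⟨fun _ => rfl, BM.const a, fun m hm => ?_⟩
  rw [integral_const_mul, nu_zz m hm, mul_zero]

lemma CtsT.ch {c : ℝ → ℂ} (hc : c ∈ CtsT) : CH c :=
  ⟨c, hc, _, Hs.const 0, by ext x; simp⟩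
lemma Hs.ch {h : ℝ → ℂ} (hh : Hs h) : CH h :=
  ⟨_, CtsT.const 0, h, hh, by ext x; simp⟩

/-- denominators -/
def den (r x : ℝ) : ℝ := 1 - 2 * r * Real.cos x + r ^ 2
/-- Poisson kernel -/
def pois (r x : ℝ) : ℝ := (1 - r ^ 2) / den r x
/-- conjugate Poisson kernel (divided by r) -/
def kap (r x : ℝ) : ℝ := 2 * Real.sin x / den r x
/-- first Cauchy kernel -/
def ka (r x : ℝ) : ℂ := (zz x - r)⁻¹
/-- second Cauchy kernel -/
def kb (r x : ℝ) : ℂ := (1 - r * zz x)⁻¹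
/-- Poisson integral at radius r -/
def PI (f : ℝ → ℂ) (r : ℝ) : ℂ := ∫ x, f x * (pois r x : ℂ) ∂nu

lemma den_eq (r x : ℝ) : den r x = (1 - r) ^ 2 + 2 * r * (1 - Real.cos x) := by
  unfold den; ring

lemma den_lower {r : ℝ} (h0 : 0 ≤ r) (x : ℝ) : (1 - r) ^ 2 ≤ den r x := by
  rw [den_eq]
  have := Real.cos_le_one x
  have : 0 ≤ 2 * r * (1 - Real.cos x) := by apply mul_nonneg <;> linarith
  linarith

lemma den_pos {r : ℝ} (h0 : 0 ≤ r) (h1 : r < 1) (x : ℝ) : 0 < den r x :=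
  lt_of_lt_of_le (by have : 0 < 1 - r := by linarith
                     positivity) (den_lower h0 x)

lemma zr_ne {r : ℝ} (h0 : 0 ≤ r) (h1 : r < 1) (x : ℝ) : zz x - r ≠ 0 := by
  intro h
  have h2 : ‖zz x‖ = ‖(r : ℂ)‖ := by rw [sub_eq_zero.1 h]
  rw [zz_norm, Complex.norm_real, Real.norm_of_nonneg h0] at h2
  linarith

lemma orz_ne {r : ℝ} (h0 : 0 ≤ r) (h1 : r < 1) (x : ℝ) : 1 - r * zz x ≠ 0 := by
  intro h
  have h2 : ‖(1 : ℂ)‖ = ‖(r : ℂ) * zz x‖ := by rw [← sub_eq_zero.1 h]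
  rw [norm_mul, zz_norm, Complex.norm_real, Real.norm_of_nonneg h0, norm_one] at h2
  linarith

lemma ka_bm {r : ℝ} (h0 : 0 ≤ r) (h1 : r < 1) : BM (ka r) := by
  refine ⟨by unfold ka; exact ((zz_cont.sub continuous_const).measurable).inv, (1 - r)⁻¹, fun x => ?_⟩
  rw [ka, norm_inv]
  apply inv_anti₀ (by linarith)
  have := norm_sub_norm_le (zz x) r
  rwa [zz_norm, Complex.norm_real, Real.norm_of_nonneg h0] at this

lemma kb_bm {r : ℝ} (h0 : 0 ≤ r) (h1 : r < 1) : BM (kb r) := by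
  refine ⟨by
    unfold kb
    exact ((continuous_const.sub (continuous_const.mul zz_cont)).measurable).inv, (1 - r)⁻¹, fun x => ?_⟩
  rw [kb, norm_inv]
  apply inv_anti₀ (by linarith)
  have := norm_sub_norm_le 1 (r * zz x)
  rwa [norm_mul, zz_norm, Complex.norm_real, Real.norm_of_nonneg h0, norm_one, mul_one] at this

lemma den_zz {r : ℝ} (x : ℝ) : (den r x : ℂ) * zz x = (zz x - r) * (1 - r * zz x) := by
  have h1 : (2 * Complex.cos x) * zz x = zz x ^ 2 + 1 := by
    have := zz_eq x; have h2 := zz_inv_eq x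
    have h3 : 2 * Complex.cos x = zz x + (zz x)⁻¹ := by rw [h2, this]; ring
    rw [h3]; field_simp [zz_ne x]
  unfold den; push_cast
  linear_combination (-(r : ℂ)) * h1

lemma pois_eq {r : ℝ} (h0 : 0 ≤ r) (h1 : r < 1) (x : ℝ) :
    (pois r x : ℂ) = zz x * ka r x + r * (zz x * kb r x) := by
  have hd : (den r x : ℂ) ≠ 0 := by exact_mod_cast (den_pos h0 h1 x).ne'
  have ha := zr_ne h0 h1 x
  have hb := orz_ne h0 h1 x
  have hz := den_zz (r := r) x
  rw [pois, ka, kb]; push_cast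
  rw [div_eq_iff hd]
  field_simp
  have : (den r x : ℂ) = (zz x - r) * (1 - r * zz x) / zz x := by
    rw [← hz]; field_simp [zz_ne x]
  rw [this]; field_simp [zz_ne x]; ring

lemma kap_eq {r : ℝ} (h0 : 0 ≤ r) (h1 : r < 1) (x : ℝ) :
    (kap r x : ℂ) = -Complex.I * (zz x * kb r x - ka r x) := by
  have hd : (den r x : ℂ) ≠ 0 := by exact_mod_cast (den_pos h0 h1 x).ne'
  have ha := zr_ne h0 h1 x
  have hb := orz_ne h0 h1 x
  have hz := den_zz (r := r) x
  have hs : 2 * Complex.sin x * zz x = -Complex.I * (zz x ^ 2 - 1) := by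
    have h3 : 2 * Complex.sin x = -Complex.I * (zz x - (zz x)⁻¹) := by
      rw [zz_inv_eq, zz_eq]; ring_nf; simp
    rw [h3]; field_simp [zz_ne x]
  rw [kap, ka, kb]; push_cast
  rw [div_eq_iff hd]
  have h4 : (zz x - r) * (1 - r * zz x) ≠ 0 := mul_ne_zero ha hb
  apply mul_right_cancel₀ (zz_ne x)
  rw [hs, mul_assoc, hz]
  have hA := mul_inv_cancel₀ ha
  have hB := mul_inv_cancel₀ hb
  linear_combination Complex.I * zz x * (zz x - r) * hB - Complex.I * (1 - r * zz x) * hA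

lemma pois_bm {r : ℝ} (h0 : 0 ≤ r) (h1 : r < 1) : BM (fun x => (pois r x : ℂ)) := by
  simp only [pois_eq h0 h1]
  have hz : BM zz := by simpa using BM.zpow 1
  exact (hz.mul (ka_bm h0 h1)).add ((BM.const _).mul (hz.mul (kb_bm h0 h1)))

lemma kap_bm {r : ℝ} (h0 : 0 ≤ r) (h1 : r < 1) : BM (fun x => (kap r x : ℂ)) := by
  simp only [kap_eq h0 h1]
  have hz : BM zz := by simpa using BM.zpow 1
  exact (BM.const _).mul ((hz.mul (kb_bm h0 h1)).sub (ka_bm h0 h1))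

lemma intB {r : ℝ} (h0 : 0 ≤ r) (h1 : r < 1) {h : ℝ → ℂ} (hh : Hs h) (m : ℕ) (hm : 1 ≤ m) :
    ∫ x, h x * (zz x ^ m * kb r x) ∂nu = 0 := by
  have step : ∀ m : ℕ, 1 ≤ m → ∫ x, h x * (zz x ^ m * kb r x) ∂nu
      = r * ∫ x, h x * (zz x ^ (m + 1) * kb r x) ∂nu := by
    intro m hm
    have e : ∀ x, h x * (zz x ^ m * kb r x)
        = h x * zz x ^ m + r * (h x * (zz x ^ (m + 1) * kb r x)) := by
      intro x
      have hb := orz_ne h0 h1 x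
      rw [kb]; field_simp; ring
    simp only [e]
    rw [integral_add ((hh.2.1.mul (BM.zpow m)).int _) (((BM.const _).mul (hh.2.1.mul
      ((BM.zpow (m + 1)).mul (kb_bm h0 h1)))).int _), hh.2.2 m hm, integral_const_mul, zero_add]
  have step2 : ∀ k : ℕ, ∫ x, h x * (zz x ^ m * kb r x) ∂nu
      = (r : ℂ) ^ k * ∫ x, h x * (zz x ^ (m + k) * kb r x) ∂nu := by
    intro k
    induction k with
    | zero => simp
    | succ k ih => rw [ih, step (m + k) (by omega)]; ring_nf
  obtain ⟨C, hC⟩ := (hh.2.1.mul (kb_bm h0 h1)).2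
  have hC0 : 0 ≤ C := (norm_nonneg _).trans (hC 0)
  have bd : ∀ k : ℕ, ‖∫ x, h x * (zz x ^ m * kb r x) ∂nu‖ ≤ r ^ k * C := by
    intro k
    rw [step2 k, norm_mul, norm_pow, Complex.norm_real, Real.norm_of_nonneg h0]
    apply mul_le_mul_of_nonneg_left _ (by positivity)
    have := norm_integral_le_of_norm_le_const (μ := nu) (f := fun x => h x * (zz x ^ (m + k) * kb r x))
      (C := C) (Eventually.of_forall fun x => by
        have := hC x
        simp only [norm_mul, norm_pow, zz_norm, one_pow, one_mul] at this ⊢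
        exact this)
    simpa using this
  have lim : Tendsto (fun k : ℕ => r ^ k * C) atTop (𝓝 0) := by
    simpa using (tendsto_pow_atTop_nhds_zero_of_lt_one h0 h1).mul_const C
  have := ge_of_tendsto' lim bd
  exact norm_le_zero_iff.1 this

lemma int_zka {r : ℝ} (h0 : 0 ≤ r) (h1 : r < 1) : ∫ x, zz x * ka r x ∂nu = 1 := by
  have := circleIntegral.integral_sub_inv_of_mem_ball (c := 0) (w := (r : ℂ)) (R := 1)
    (by simp [abs_of_nonneg h0, h1])
  rw [circleIntegral] at this
  rw [nu_int, Complex.real_smul]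
  have e : ∀ θ : ℝ, deriv (circleMap 0 1) θ • (circleMap 0 1 θ - (r : ℂ))⁻¹
      = Complex.I * (zz θ * ka r θ) := by
    intro θ
    have : circleMap 0 1 θ = zz θ := by simp [circleMap, zz, mul_comm]
    rw [deriv_circleMap, this, ka, smul_eq_mul]; ring
  simp only [e] at this
  rw [intervalIntegral.integral_const_mul] at this
  have h3 : ∫ x in (0 : ℝ)..(2 * π), zz x * ka r x = 2 * π := by
    apply mul_left_cancel₀ Complex.I_ne_zero
    rw [this]; ring
  rw [h3]; push_cast
  have : (π : ℂ) ≠ 0 := by exact_mod_cast Real.pi_ne_zero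
  field_simp

lemma PI_eq {r : ℝ} (h0 : 0 ≤ r) (h1 : r < 1) {h : ℝ → ℂ} (hh : Hs h) :
    PI h r = ∫ x, h x * (zz x * ka r x) ∂nu := by
  have hz : BM zz := by simpa using BM.zpow 1
  unfold PI
  simp only [pois_eq h0 h1, mul_add]
  rw [integral_add ((hh.2.1.mul (hz.mul (ka_bm h0 h1))).int _)
    ((hh.2.1.mul ((BM.const _).mul (hz.mul (kb_bm h0 h1)))).int _)]
  have := intB h0 h1 hh 1 le_rfl
  have e : ∀ x, h x * (r * (zz x * kb r x)) = r * (h x * (zz x ^ 1 * kb r x)) := by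
    intro x; ring
  simp only [e]
  rw [integral_const_mul, this, mul_zero, add_zero]

lemma PI_const {r : ℝ} (h0 : 0 ≤ r) (h1 : r < 1) (a : ℂ) : PI (fun _ => a) r = a := by
  rw [PI_eq h0 h1 (Hs.const a), integral_const_mul, int_zka h0 h1, mul_one]

lemma intA {r : ℝ} (h0 : 0 ≤ r) (h1 : r < 1) {h : ℝ → ℂ} (hh : Hs h) (m : ℕ) :
    ∫ x, (h x - PI h r) * (zz x ^ (m + 1) * ka r x) ∂nu = 0 := by
  have hz : BM zz := by simpa using BM.zpow 1
  have hs := hh.sub (Hs.const (PI h r))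
  induction m with
  | zero =>
    simp only [zero_add, pow_one, sub_mul]
    rw [integral_sub ((hh.2.1.mul (hz.mul (ka_bm h0 h1))).int _)
      (((BM.const _).mul (hz.mul (ka_bm h0 h1))).int _), integral_const_mul, int_zka h0 h1,
      ← PI_eq h0 h1 hh, mul_one, sub_self]
  | succ m ih =>
    have e : ∀ x, (h x - PI h r) * (zz x ^ (m + 1 + 1) * ka r x)
        = (h x - PI h r) * zz x ^ (m + 1) + r * ((h x - PI h r) * (zz x ^ (m + 1) * ka r x)) := by
      intro x
      have hb := zr_ne h0 h1 x
      rw [ka]; field_simp; ring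
    simp only [e]
    rw [integral_add ((hs.2.1.mul (BM.zpow _)).int _) (((BM.const _).mul (hs.2.1.mul
      ((BM.zpow (m + 1)).mul (ka_bm h0 h1)))).int _), hs.2.2 _ (by omega), integral_const_mul, ih]
    simp

lemma int_u {r : ℝ} (h0 : 0 ≤ r) (h1 : r < 1) {h : ℝ → ℂ} (hh : Hs h) (m : ℕ) :
    ∫ x, ((h x - PI h r) * pois r x) * zz x ^ m ∂nu = 0 := by
  have hs := hh.sub (Hs.const (PI h r))
  have e : ∀ x, ((h x - PI h r) * pois r x) * zz x ^ m
      = (h x - PI h r) * (zz x ^ (m + 1) * ka r x)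
        + r * ((h x - PI h r) * (zz x ^ (m + 1) * kb r x)) := by
    intro x; rw [pois_eq h0 h1]; ring
  simp only [e]
  rw [integral_add ((hs.2.1.mul ((BM.zpow (m + 1)).mul (ka_bm h0 h1))).int _)
    (((BM.const _).mul (hs.2.1.mul ((BM.zpow (m + 1)).mul (kb_bm h0 h1)))).int _),
    intA h0 h1 hh, integral_const_mul, intB h0 h1 hs _ (by omega)]
  simp

lemma int_k {r : ℝ} (h0 : 0 ≤ r) (h1 : r < 1) {h : ℝ → ℂ} (hh : Hs h) (m : ℕ) (hm : 1 ≤ m) :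
    ∫ x, ((h x - PI h r) * kap r x) * zz x ^ m ∂nu = 0 := by
  obtain ⟨k, rfl⟩ : ∃ k, m = k + 1 := ⟨m - 1, by omega⟩
  have hs := hh.sub (Hs.const (PI h r))
  have e : ∀ x, ((h x - PI h r) * kap r x) * zz x ^ (k + 1)
      = -Complex.I * ((h x - PI h r) * (zz x ^ (k + 2) * kb r x))
        + Complex.I * ((h x - PI h r) * (zz x ^ (k + 1) * ka r x)) := by
    intro x; rw [kap_eq h0 h1]; ring
  simp only [e]
  rw [integral_add (((BM.const _).mul (hs.2.1.mul ((BM.zpow (k + 2)).mul (kb_bm h0 h1)))).int _)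
    (((BM.const _).mul (hs.2.1.mul ((BM.zpow (k + 1)).mul (ka_bm h0 h1)))).int _),
    integral_const_mul, integral_const_mul,
    intA h0 h1 hh, intB h0 h1 hs _ (by omega)]
  simp

lemma fco_eq (f : ℝ → ℂ) (n : ℤ) :
    fourierCoeffOn two_pi_pos' f n = fourierCoef f n := by
  rw [fourierCoeffOn_eq_integral, fourierCoef, sub_zero, Complex.real_smul]
  congr 1
  · push_cast; rfl
  · congr 1; ext x
    rw [fourier_coe_apply, smul_eq_mul, mul_comm]
    congr 2
    have : (π : ℂ) ≠ 0 := by exact_mod_cast Real.pi_ne_zero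
    push_cast; field_simp

lemma pars {f : ℝ → ℂ} (hf : BM f) :
    HasSum (fun i : ℤ => ‖fourierCoef f i‖ ^ 2) (∫ x, ‖f x‖ ^ 2 ∂nu) := by
  have hL : MemLp f 2 (volume.restrict (Set.Ioc 0 (2 * π))) := by
    obtain ⟨C, hC⟩ := hf.2
    exact MemLp.of_bound hf.1.aestronglyMeasurable C (Eventually.of_forall hC)
  have := hasSum_sq_fourierCoeffOn two_pi_pos' hL
  simp only [fco_eq, sub_zero] at this
  rw [nu_int, one_div]; exact this

lemma fc_pos_conj (f : ℝ → ℂ) (m : ℕ) :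
    fourierCoef (fun x => (starRingEnd ℂ) (f x)) (m : ℤ)
      = (starRingEnd ℂ) (∫ x, f x * zz x ^ m ∂nu) := by
  rw [← integral_conj, nu_int, Complex.real_smul, fourierCoef]
  congr 1
  · push_cast; rfl
  · congr 1; ext x
    simp only [map_mul, map_pow, zz_conj]
    rw [zz, ← Complex.exp_neg, ← Complex.exp_nat_mul]; push_cast; ring_nf

lemma fc_add {f g : ℝ → ℂ} (hf : BM f) (hg : BM g) (n : ℤ) :
    fourierCoef (fun x => f x + g x) n = fourierCoef f n + fourierCoef g n := by
  have hE : BM (fun x : ℝ => Complex.exp (-(Complex.I * n * x))) := by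
    refine ⟨by fun_prop, 1, fun x => ?_⟩
    rw [Complex.norm_exp]; simp
  simp only [fourierCoef, add_mul]
  rw [intervalIntegral.integral_add ((hf.mul hE).ii _ _) ((hg.mul hE).ii _ _), mul_add]

lemma re_zero {u v : ℝ → ℂ} (hu : BM u) (hu0 : ∀ m : ℕ, ∫ x, u x * zz x ^ m ∂nu = 0) (hv : Hs v) :
    (∫ x, u x * v x ∂nu).re = 0 := by
  have h1 := pars hu.conj
  have h2 := pars hv.2.1
  have h3 := pars (hu.conj.add hv.2.1)
  have h4 : ∀ i : ℤ, ‖fourierCoef (fun x => (starRingEnd ℂ) (u x) + v x) i‖ ^ 2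
      = ‖fourierCoef (fun x => (starRingEnd ℂ) (u x)) i‖ ^ 2 + ‖fourierCoef v i‖ ^ 2 := by
    intro i
    rw [fc_add hu.conj hv.2.1]
    rcases le_or_gt 0 i with hi | hi
    · obtain ⟨m, rfl⟩ : ∃ m : ℕ, i = (m : ℤ) := ⟨i.natAbs, by omega⟩
      rw [fc_pos_conj, hu0]; simp
    · obtain ⟨m, rfl⟩ : ∃ m : ℕ, i = -(m : ℤ) := ⟨i.natAbs, by omega⟩
      rw [fc_neg v, hv.2.2 m (by omega)]; simp
  simp only [h4] at h3
  have h5 := h3.unique (h1.add h2)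
  have i1 : Integrable (fun x => ‖(starRingEnd ℂ) (u x)‖ ^ 2) nu := by
    obtain ⟨C, hC⟩ := hu.conj.2
    refine Integrable.of_bound (hu.conj.1.norm.pow_const 2).aestronglyMeasurable (C ^ 2)
      (Eventually.of_forall fun x => ?_)
    rw [norm_pow, norm_norm]; exact pow_le_pow_left₀ (norm_nonneg _) (hC x) 2
  have i2 : Integrable (fun x => ‖v x‖ ^ 2) nu := by
    obtain ⟨C, hC⟩ := hv.2.1.2
    refine Integrable.of_bound (hv.2.1.1.norm.pow_const 2).aestronglyMeasurable (C ^ 2)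
      (Eventually.of_forall fun x => ?_)
    rw [norm_pow, norm_norm]; exact pow_le_pow_left₀ (norm_nonneg _) (hC x) 2
  have i3 : Integrable (fun x => u x * v x) nu := (hu.mul hv.2.1).int _
  have h6 : ∀ x, ‖(starRingEnd ℂ) (u x) + v x‖ ^ 2
      = ‖(starRingEnd ℂ) (u x)‖ ^ 2 + ‖v x‖ ^ 2 + 2 * (u x * v x).re := by
    intro x
    simp only [← Complex.normSq_eq_norm_sq, Complex.normSq_apply, Complex.add_re, Complex.add_im,
      Complex.conj_re, Complex.conj_im, Complex.mul_re]
    ring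
  simp only [h6] at h5
  have i4 : Integrable (fun x => 2 * (u x * v x).re) nu := i3.re.const_mul 2
  have i12 : Integrable (fun x => ‖(starRingEnd ℂ) (u x)‖ ^ 2 + ‖v x‖ ^ 2) nu := i1.add i2
  rw [integral_add i12 i4, integral_add i1 i2, integral_const_mul] at h5
  have h7 : ∫ x, (u x * v x).re ∂nu = (∫ x, u x * v x ∂nu).re := integral_re i3
  rw [h7] at h5
  linarith

lemma mul_zero_int {u v : ℝ → ℂ} (hu : BM u) (hu0 : ∀ m : ℕ, ∫ x, u x * zz x ^ m ∂nu = 0)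
    (hv : Hs v) : ∫ x, u x * v x ∂nu = 0 := by
  apply Complex.ext
  · exact re_zero hu hu0 hv
  · have := re_zero hu hu0 (hv.smul Complex.I)
    have e : ∀ x, u x * (Complex.I * v x) = Complex.I * (u x * v x) := fun x => by ring
    simp only [e] at this
    rw [integral_const_mul] at this
    simpa using this

lemma PI_mul {r : ℝ} (h0 : 0 ≤ r) (h1 : r < 1) {h g : ℝ → ℂ} (hh : Hs h) (hg : Hs g) :
    PI (fun x => h x * g x) r = PI h r * PI g r := by
  have hs := hh.sub (Hs.const (PI h r))
  have hp := pois_bm h0 h1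
  have := mul_zero_int (hs.2.1.mul hp) (int_u h0 h1 hh) hg
  have e : ∀ x, (h x - PI h r) * (pois r x : ℂ) * g x
      = h x * g x * (pois r x) - PI h r * (g x * pois r x) := fun x => by ring
  simp only [e] at this
  rw [integral_sub (((hh.2.1.mul hg.2.1).mul hp).int _)
    (((BM.const _).mul (hg.2.1.mul hp)).int _), integral_const_mul] at this
  exact sub_eq_zero.1 this

lemma PI_add {r : ℝ} (h0 : 0 ≤ r) (h1 : r < 1) {f g : ℝ → ℂ} (hf : BM f) (hg : BM g) :
    PI (fun x => f x + g x) r = PI f r + PI g r := by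
  unfold PI
  simp only [add_mul]
  exact integral_add ((hf.mul (pois_bm h0 h1)).int _) ((hg.mul (pois_bm h0 h1)).int _)

lemma PI_smul {r : ℝ} (a : ℂ) (f : ℝ → ℂ) :
    PI (fun x => a * f x) r = a * PI f r := by
  unfold PI
  simp only [mul_assoc]
  exact integral_const_mul _ _

lemma pois_nonneg {r : ℝ} (h0 : 0 ≤ r) (h1 : r < 1) (x : ℝ) : 0 ≤ pois r x :=
  div_nonneg (by nlinarith) (den_pos h0 h1 x).le

lemma pois_int {r : ℝ} (h0 : 0 ≤ r) (h1 : r < 1) : ∫ x, pois r x ∂nu = 1 := by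
  have := PI_const h0 h1 1
  simp only [PI, one_mul] at this
  rw [integral_complex_ofReal] at this
  exact_mod_cast this

lemma pois_integrable {r : ℝ} (h0 : 0 ≤ r) (h1 : r < 1) : Integrable (pois r) nu := by
  have := ((pois_bm h0 h1).int nu).re
  simpa using this

lemma pois_int_mul {r : ℝ} (h0 : 0 ≤ r) (h1 : r < 1) {g : ℝ → ℝ} (hg : Measurable g) {C : ℝ}
    (hC : ∀ x, |g x| ≤ C) : Integrable (fun x => g x * pois r x) nu :=
  (pois_integrable h0 h1).bdd_mul hg.aestronglyMeasurable (Eventually.of_forall hC)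

lemma PI_bound {r : ℝ} (h0 : 0 ≤ r) (h1 : r < 1) {f : ℝ → ℂ} {C : ℝ} (hf : Measurable f)
    (hC : ∀ x, ‖f x‖ ≤ C) : ‖PI f r‖ ≤ C := by
  unfold PI
  have h2 : ∫ x, C * pois r x ∂nu = C := by rw [integral_const_mul, pois_int h0 h1, mul_one]
  rw [← h2]
  apply norm_integral_le_of_norm_le ((pois_integrable h0 h1).const_mul C)
  refine Eventually.of_forall fun x => ?_
  rw [norm_mul, Complex.norm_real, Real.norm_of_nonneg (pois_nonneg h0 h1 x)]
  exact mul_le_mul_of_nonneg_right (hC x) (pois_nonneg h0 h1 x)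

lemma PI_conj {r : ℝ} (f : ℝ → ℂ) :
    PI (fun x => (starRingEnd ℂ) (f x)) r = (starRingEnd ℂ) (PI f r) := by
  unfold PI
  rw [← integral_conj]
  simp

/-- pointwise bound with cosine -/
lemma cos_dom {c : ℝ → ℂ} (hc : c ∈ CtsT) {ε : ℝ} (hε : 0 < ε) :
    ∃ M, 0 ≤ M ∧ ∀ x, ‖c x - c 0‖ ≤ ε + M * (1 - Real.cos x) := by
  obtain ⟨hp, hc'⟩ := hc
  obtain ⟨_, C, hC⟩ := cts_bdd ⟨hp, hc'⟩
  have hC0 : 0 ≤ C := (norm_nonneg _).trans (hC 0)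
  obtain ⟨δ, hδ, hd⟩ := Metric.continuousAt_iff.1 hc'.continuousAt ε hε
  set d := min δ 1 with hdd
  have hd0 : 0 < d := lt_min hδ one_pos
  have hd1 : d ≤ 1 := min_le_right _ _
  have hpi := Real.pi_gt_three
  have hcos : Real.cos d < 1 := by
    rw [← Real.cos_zero]
    exact Real.cos_lt_cos_of_nonneg_of_le_pi le_rfl (by linarith) hd0
  have hm : 0 < 1 - Real.cos d := by linarith
  refine ⟨2 * C / (1 - Real.cos d), by positivity, fun x => ?_⟩
  have key : ∀ y ∈ Set.Icc (-π) π, ‖c y - c 0‖ ≤ ε + 2 * C / (1 - Real.cos d) * (1 - Real.cos y) := by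
    intro y hy
    have h1 := Real.cos_le_one y
    rcases lt_or_ge |y| d with h | h
    · have := hd (x := y) (by rw [Real.dist_eq, sub_zero]; exact lt_of_lt_of_le h (min_le_left _ _))
      rw [dist_eq_norm] at this
      have : 0 ≤ 2 * C / (1 - Real.cos d) * (1 - Real.cos y) := by
        apply mul_nonneg (by positivity); linarith
      linarith
    · have hy' : |y| ≤ π := abs_le.2 hy
      have h2 : Real.cos y ≤ Real.cos d := by
        rw [← Real.cos_abs y]
        exact Real.cos_le_cos_of_nonneg_of_le_pi hd0.le hy' h
      have h3 : 2 * C ≤ 2 * C / (1 - Real.cos d) * (1 - Real.cos y) := by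
        rw [div_mul_eq_mul_div, le_div_iff₀ hm]
        apply mul_le_mul_of_nonneg_left _ (by positivity); linarith
      have h4 := norm_sub_le (c y) (c 0)
      have := hC y; have := hC 0
      linarith
  obtain ⟨n, hn⟩ : ∃ n : ℤ, x - n * (2 * π) ∈ Set.Icc (-π) π := by
    refine ⟨toIcoDiv two_pi_pos' (-π) x, ?_⟩
    have := sub_toIcoDiv_zsmul_mem_Ico two_pi_pos' (-π) x
    rw [zsmul_eq_mul] at this
    exact ⟨this.1, by have := this.2; linarith⟩
  have := key _ hn
  rwa [hp.sub_int_mul_eq, Real.cos_sub_int_mul_two_pi] at this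

lemma pois_cos {r : ℝ} (h0 : 0 < r) (h1 : r < 1) (x : ℝ) :
    (1 - Real.cos x) * pois r x ≤ (1 - r ^ 2) / (2 * r) := by
  have hd := den_pos h0.le h1 x
  rw [pois, mul_div_assoc', div_le_div_iff₀ hd (by positivity)]
  have : 2 * r * (1 - Real.cos x) ≤ den r x := by rw [den_eq]; nlinarith [sq_nonneg (1 - r)]
  have h3 : 0 ≤ 1 - r ^ 2 := by nlinarith
  nlinarith

/-- key approximate identity estimate -/
lemma PI_small {c : ℝ → ℂ} (hc : c ∈ CtsT) {g : ℝ → ℂ} (hg : BM g) :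
    Tendsto (fun r => PI (fun x => (c x - c 0) * g x) r) (𝓝[<] 1) (𝓝 0) := by
  rw [Metric.tendsto_nhds]
  intro ε hε
  obtain ⟨_, C, hC⟩ := id hg
  have hC0 : 0 ≤ C := (norm_nonneg _).trans (hC 0)
  obtain ⟨M, hM, hb⟩ := cos_dom hc (show 0 < ε / (2 * (C + 1)) by positivity)
  have lim : Tendsto (fun r : ℝ => C * (ε / (2 * (C + 1)) + M * ((1 - r ^ 2) / (2 * r)))) (𝓝[<] 1)
      (𝓝 (C * (ε / (2 * (C + 1)) + M * ((1 - 1 ^ 2) / (2 * 1))))) := by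
    apply Tendsto.mono_left _ nhdsWithin_le_nhds
    apply ContinuousAt.tendsto (f := fun r : ℝ => C * (ε / (2 * (C + 1)) + M * ((1 - r ^ 2) / (2 * r))))
    fun_prop (disch := norm_num)
  have lt : C * (ε / (2 * (C + 1)) + M * ((1 - 1 ^ 2) / (2 * 1))) < ε := by
    have : C * (ε / (2 * (C + 1))) < ε := by
      rw [mul_div_assoc', div_lt_iff₀ (by positivity)]; nlinarith
    simpa using this
  have hlow : ∀ᶠ r : ℝ in 𝓝[<] 1, 0 < r := nhdsWithin_le_nhds (lt_mem_nhds one_pos)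
  filter_upwards [lim.eventually (gt_mem_nhds lt), hlow, self_mem_nhdsWithin] with r hr h0 h1
  have h1 : r < 1 := h1
  rw [dist_zero_right]
  refine lt_of_le_of_lt ?_ hr
  have hi : Integrable (fun x => C * (ε / (2 * (C + 1)) * pois r x + M * ((1 - r ^ 2) / (2 * r)))) nu :=
    (((pois_integrable h0.le h1).const_mul _).add (integrable_const _)).const_mul C
  have := norm_integral_le_of_norm_le hi (f := fun x => (c x - c 0) * g x * (pois r x : ℂ))
    (Eventually.of_forall fun x => ?_)
  · rw [integral_const_mul, integral_add ((pois_integrable h0.le h1).const_mul _) (integrable_const _),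
      integral_const_mul, pois_int h0.le h1] at this
    unfold PI
    simpa using this
  · have hp := pois_nonneg h0.le h1 x
    rw [norm_mul, norm_mul, Complex.norm_real, Real.norm_of_nonneg hp]
    have h2 := pois_cos h0 h1 x
    calc ‖c x - c 0‖ * ‖g x‖ * pois r x
        ≤ (ε / (2 * (C + 1)) + M * (1 - Real.cos x)) * C * pois r x := by
          gcongr
          · exact (norm_nonneg _).trans (hb x)
          · exact hb x
          · exact hC x
      _ = C * (ε / (2 * (C + 1)) * pois r x + M * ((1 - Real.cos x) * pois r x)) := by ring
      _ ≤ _ := by gcongr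


lemma ev01 : ∀ᶠ r : ℝ in 𝓝[<] 1, 0 < r ∧ r < 1 := by
  have hlow : ∀ᶠ r : ℝ in 𝓝[<] 1, 0 < r := nhdsWithin_le_nhds (lt_mem_nhds one_pos)
  filter_upwards [hlow, self_mem_nhdsWithin] with r h0 h1 using ⟨h0, h1⟩

lemma CH.nf {f : ℝ → ℂ} (hf : CH f) : ∃ c ∈ CtsT, c 0 = 0 ∧ ∃ h, Hs h ∧ f = fun x => c x + h x := by
  obtain ⟨c, hc, h, hh, rfl⟩ := hf
  refine ⟨_, CtsT.sub hc (CtsT.const (c 0)), by simp, _, hh.add (Hs.const (c 0)), ?_⟩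
  ext x; simp

lemma PI_small0 {c : ℝ → ℂ} (hc : c ∈ CtsT) (h0 : c 0 = 0) {g : ℝ → ℂ} (hg : BM g) :
    Tendsto (fun r => PI (fun x => c x * g x) r) (𝓝[<] 1) (𝓝 0) := by
  simpa [h0] using PI_small hc hg

lemma PI_small1 {c : ℝ → ℂ} (hc : c ∈ CtsT) (h0 : c 0 = 0) :
    Tendsto (fun r => PI c r) (𝓝[<] 1) (𝓝 0) := by
  simpa using PI_small0 hc h0 (BM.const 1)

lemma PI_bd {g : ℝ → ℂ} (hg : BM g) : ∃ C, ∀ r, 0 < r ∧ r < 1 → ‖PI g r‖ ≤ C := by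
  obtain ⟨m, C, hC⟩ := hg
  exact ⟨C, fun r hr => PI_bound hr.1.le hr.2 m hC⟩

lemma PI_bdd_mul {u : ℝ → ℂ} (hu : Tendsto u (𝓝[<] 1) (𝓝 0)) {g : ℝ → ℂ} (hg : BM g) :
    Tendsto (fun r => u r * PI g r) (𝓝[<] 1) (𝓝 0) := by
  obtain ⟨C, hC⟩ := PI_bd hg
  apply squeeze_zero_norm' (a := fun r => ‖u r‖ * C)
  · filter_upwards [ev01] with r hr
    rw [norm_mul]; exact mul_le_mul_of_nonneg_left (hC r hr) (norm_nonneg _)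
  · simpa using hu.norm.mul_const C

lemma PI_asym {f g : ℝ → ℂ} (hf : CH f) (hg : CH g) :
    Tendsto (fun r => PI (fun x => f x * g x) r - PI f r * PI g r) (𝓝[<] 1) (𝓝 0) := by
  have gb := hg.bm
  obtain ⟨c, hc, c0, h, hh, rfl⟩ := hf.nf
  obtain ⟨c', hc', c0', h', hh', e⟩ := hg.nf
  have A := PI_small0 hc c0 gb
  have B := PI_small0 hc' c0' hh.2.1
  have a := PI_bdd_mul (PI_small1 hc c0) gb
  have b := PI_bdd_mul (PI_small1 hc' c0') hh.2.1
  have T := ((A.add B).sub a).sub b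
  simp only [add_zero, sub_zero] at T
  refine T.congr' ?_
  filter_upwards [ev01] with r hr
  have e1 : PI (fun x => (c x + h x) * g x) r
      = PI (fun x => c x * g x) r + (PI (fun x => c' x * h x) r + PI h r * PI h' r) := by
    rw [← PI_mul hr.1.le hr.2 hh hh',
      ← PI_add hr.1.le hr.2 ((cts_bdd hc').mul hh.2.1) (hh.2.1.mul hh'.2.1),
      ← PI_add hr.1.le hr.2 ((cts_bdd hc).mul gb)
        (((cts_bdd hc').mul hh.2.1).add (hh.2.1.mul hh'.2.1))]
    congr 1; ext x; rw [e]; ring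
  have e2 : PI g r = PI c' r + PI h' r := by
    rw [← PI_add hr.1.le hr.2 (cts_bdd hc') hh'.2.1, e]
  rw [e1, PI_add hr.1.le hr.2 (cts_bdd hc) hh.2.1, e2]
  ring

lemma pois_ge {r x : ℝ} (h0 : 0 < r) (h1 : r < 1) (hx : |x| ≤ 1 - r) : 1 / (1 - r) ≤ pois r x := by
  have hd := den_pos h0.le h1 x
  have hs : 0 < 1 - r := by linarith
  rw [pois, div_le_div_iff₀ hs hd, den_eq]
  have h2 := Real.one_sub_sq_div_two_le_cos (x := x)
  have h3 : x ^ 2 ≤ (1 - r) ^ 2 := by rw [← sq_abs]; exact pow_le_pow_left₀ (abs_nonneg x) hx 2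
  nlinarith

lemma den_per (r : ℝ) : Function.Periodic (den r) (2 * π) := by
  intro x; simp [den]

lemma pois_per (r : ℝ) : Function.Periodic (pois r) (2 * π) := by
  intro x; simp [pois, den_per r x]

lemma kap_per (r : ℝ) : Function.Periodic (kap r) (2 * π) := by
  intro x; simp [kap, den_per r x]

lemma avg_le {r : ℝ} (h0 : 0 < r) (h1 : r < 1) {g : ℝ → ℝ} (hp : Function.Periodic g (2 * π))
    (hm : Measurable g) {C : ℝ} (hC : ∀ x, |g x| ≤ C) (hg : ∀ x, 0 ≤ g x) :
    ∫ x in (-(1 - r))..(1 - r), g x ≤ 2 * π * (1 - r) * ∫ x, g x * pois r x ∂nu := by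
  have hs : 0 < 1 - r := by linarith
  have hpi := Real.pi_gt_three
  have hpb := pois_bm h0.le h1
  have hbm : BM (fun x => ((g x * pois r x : ℝ) : ℂ)) := by
    have h3 : BM (fun x => (g x : ℂ)) :=
      ⟨Complex.measurable_ofReal.comp hm, C, fun x => by simpa using hC x⟩
    simpa using h3.mul hpb
  have hgi : ∀ a b, IntervalIntegrable g volume a b := by
    intro a b
    have h3 : BM (fun x => (g x : ℂ)) :=
      ⟨Complex.measurable_ofReal.comp hm, C, fun x => by simpa using hC x⟩
    have := (h3.ii a b)
    rw [intervalIntegrable_iff] at this ⊢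
    have h := this.re
    simp only [RCLike.re_eq_complex_re, Complex.ofReal_re] at h
    exact h
  have hgpi : ∀ a b, IntervalIntegrable (fun x => g x * pois r x) volume a b := by
    intro a b
    have := (hbm.ii a b)
    rw [intervalIntegrable_iff] at this ⊢
    have h := this.re
    simp only [RCLike.re_eq_complex_re, Complex.ofReal_re] at h
    exact h
  rw [show ∫ x, g x * pois r x ∂nu = (1 / (2 * π)) • ∫ x in (-π)..π, g x * pois r x from
    nu_int_sym (hp.mul (pois_per r)), smul_eq_mul]
  have e : 2 * π * (1 - r) * (1 / (2 * π) * ∫ x in (-π)..π, g x * pois r x)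
      = (1 - r) * ∫ x in (-π)..π, g x * pois r x := by field_simp
  have h4 : ∫ x in (-(1 - r))..(1 - r), g x * (1 / (1 - r)) ≤ ∫ x in (-π)..π, g x * pois r x := by
    calc _ ≤ ∫ x in (-(1 - r))..(1 - r), g x * pois r x := by
          apply intervalIntegral.integral_mono_on (by linarith) ((hgi _ _).mul_const _) (hgpi _ _)
          intro x hx
          exact mul_le_mul_of_nonneg_left (pois_ge h0 h1 (abs_le.2 hx)) (hg x)
      _ ≤ _ := by
          apply intervalIntegral.integral_mono_interval (by linarith) (by linarith) (by linarith) _ (hgpi _ _)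
          exact Eventually.of_forall fun x => mul_nonneg (hg x) (pois_nonneg h0.le h1 x)
  rw [intervalIntegral.integral_mul_const] at h4
  have h5 : (1 - r) * ((∫ x in (-(1 - r))..(1 - r), g x) * (1 / (1 - r))) ≤
    (1 - r) * ∫ x in (-π)..π, g x * pois r x := mul_le_mul_of_nonneg_left h4 hs.le
  have e2 : (1 - r) * ((∫ x in (-(1 - r))..(1 - r), g x) * (1 / (1 - r)))
    = ∫ x in (-(1 - r))..(1 - r), g x := by field_simp
  rw [e]; linarith

lemma movAvg_eq {s : ℝ} (hs : 0 < s) (f : ℝ → ℂ) :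
    movAvg f (π / s) 0 = ((1 / (2 * s) : ℝ) : ℂ) * ∫ x in (-s)..s, f x := by
  have hpi := Real.pi_pos
  have e1 : π / (π / s) = s := by field_simp
  have hc : (π : ℂ) ≠ 0 := by exact_mod_cast hpi.ne'
  have hc' : (s : ℂ) ≠ 0 := by exact_mod_cast hs.ne'
  rw [movAvg, e1, zero_sub, zero_add]
  congr 1
  push_cast
  field_simp

lemma movAvg_bound {r : ℝ} (h0 : 0 < r) (h1 : r < 1) {f : ℝ → ℂ} (hp : Function.Periodic f (2 * π))
    (hf : BM f) {η : ℝ} (hη : 0 < η) (m : ℂ) :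
    ‖movAvg f (π / (1 - r)) 0 - m‖ ≤ η + π / η * ∫ x, ‖f x - m‖ ^ 2 * pois r x ∂nu := by
  have hs : 0 < 1 - r := by linarith
  obtain ⟨s, hsd⟩ : ∃ s, s = 1 - r := ⟨_, rfl⟩
  rw [← hsd] at hs ⊢
  have hsc : (s : ℂ) ≠ 0 := by exact_mod_cast hs.ne'
  have hb : BM (fun x => f x - m) := hf.sub (BM.const m)
  obtain ⟨hbm, C, hC⟩ := id hb
  have hi : IntervalIntegrable (fun x => ‖f x - m‖ ^ 2) volume (-s) s := by
    have h := (hb.mul hb.conj).ii (-s) s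
    rw [intervalIntegrable_iff] at h ⊢
    refine h.re.congr (Eventually.of_forall fun x => ?_)
    simp only [Complex.mul_conj, Complex.normSq_eq_norm_sq]
    norm_cast
  have e : movAvg f (π / s) 0 - m = ((1 / (2 * s) : ℝ) : ℂ) * ∫ x in (-s)..s, (f x - m) := by
    rw [movAvg_eq hs, intervalIntegral.integral_sub (hf.ii _ _) (by simp), intervalIntegral.integral_const]
    rw [mul_sub, Complex.real_smul]; push_cast; field_simp; ring
  rw [e, norm_mul, Complex.norm_real, Real.norm_of_nonneg (by positivity)]
  have h2 : ‖∫ x in (-s)..s, (f x - m)‖ ≤ ∫ x in (-s)..s, (η + (1 / η) * ‖f x - m‖ ^ 2) := by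
    apply intervalIntegral.norm_integral_le_of_norm_le (by linarith)
    · refine Eventually.of_forall fun x _ => ?_
      have h3 : 0 ≤ (1 / η) * (‖f x - m‖ - η / 2) ^ 2 := by positivity
      have h4 : (1 / η) * (‖f x - m‖ - η / 2) ^ 2 = (1 / η) * ‖f x - m‖ ^ 2 - ‖f x - m‖ + η / 4 := by
        field_simp; ring
      linarith
    · exact (intervalIntegrable_const).add (hi.const_mul _)
  rw [intervalIntegral.integral_add intervalIntegrable_const (hi.const_mul _),
    intervalIntegral.integral_const, intervalIntegral.integral_const_mul] at h2
  have h5 := avg_le h0 h1 (g := fun x => ‖f x - m‖ ^ 2) (fun x => by simp [hp x])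
    (hbm.norm.pow_const 2) (C := C ^ 2) (fun x => by
      rw [abs_of_nonneg (by positivity)]; exact pow_le_pow_left₀ (norm_nonneg _) (hC x) 2)
    (fun x => by positivity)
  rw [← hsd] at h5
  set V := ∫ x, ‖f x - m‖ ^ 2 * pois r x ∂nu with hV
  set W := ∫ x in (-s)..s, ‖f x - m‖ ^ 2 with hW
  calc 1 / (2 * s) * ‖∫ x in (-s)..s, (f x - m)‖
      ≤ 1 / (2 * s) * ((s - -s) • η + 1 / η * (2 * π * s * V)) := by
        gcongr
        refine h2.trans ?_
        gcongr
    _ = η + π / η * V := by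
        rw [smul_eq_mul]; field_simp; ring

lemma var_eq {r : ℝ} (h0 : 0 < r) (h1 : r < 1) {f : ℝ → ℂ} (hf : BM f) :
    ((∫ x, ‖f x - PI f r‖ ^ 2 * pois r x ∂nu : ℝ) : ℂ)
      = PI (fun x => f x * (starRingEnd ℂ) (f x)) r
        - PI f r * PI (fun x => (starRingEnd ℂ) (f x)) r := by
  rw [← integral_complex_ofReal]
  set m := PI f r with hm
  have e : ∀ x, ((‖f x - m‖ ^ 2 * pois r x : ℝ) : ℂ)
      = (((f x * (starRingEnd ℂ) (f x)) + (-(starRingEnd ℂ) m) * f x)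
        + (-m * (starRingEnd ℂ) (f x) + m * (starRingEnd ℂ) m)) * (pois r x : ℂ) := by
    intro x
    rw [Complex.ofReal_mul, ← Complex.normSq_eq_norm_sq, ← Complex.mul_conj, map_sub]; ring
  simp only [e]
  change PI (fun x => ((f x * (starRingEnd ℂ) (f x)) + (-(starRingEnd ℂ) m) * f x)
        + (-m * (starRingEnd ℂ) (f x) + m * (starRingEnd ℂ) m)) r = _
  have b1 := hf.mul hf.conj
  have b2 := (BM.const (-(starRingEnd ℂ) m)).mul hf
  have b3 := (BM.const (-m)).mul hf.conj
  have b4 := BM.const (m * (starRingEnd ℂ) m)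
  rw [PI_add h0.le h1 (b1.add b2) (b3.add b4), PI_add h0.le h1 b1 b2, PI_add h0.le h1 b3 b4,
    PI_smul, PI_smul, PI_const h0.le h1, PI_conj, ← hm]
  ring

lemma movAvg_PI {f : ℝ → ℂ} (hf : f ∈ QCset) :
    Tendsto (fun r => movAvg f (π / (1 - r)) 0 - PI f r) (𝓝[<] 1) (𝓝 0) := by
  obtain ⟨h1, h2⟩ := QC_iff.1 hf
  have hb := h1.bm
  have T := (PI_asym h1 h2).norm
  rw [norm_zero] at T
  rw [Metric.tendsto_nhds]
  intro ε hε
  have T2 := (T.const_mul (π / (ε / 2)))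
  rw [mul_zero] at T2
  filter_upwards [ev01, T2.eventually (gt_mem_nhds (half_pos hε))] with r hr hr2
  rw [dist_zero_right]
  refine (movAvg_bound hr.1 hr.2 h1.per hb (half_pos hε) (PI f r)).trans_lt ?_
  rw [← var_eq hr.1 hr.2 hb, Complex.norm_real] at hr2
  have h3 := Real.le_norm_self (∫ x, ‖f x - PI f r‖ ^ 2 * pois r x ∂nu)
  have h4 : π / (ε / 2) * (∫ x, ‖f x - PI f r‖ ^ 2 * pois r x ∂nu)
      ≤ π / (ε / 2) * ‖∫ x, ‖f x - PI f r‖ ^ 2 * pois r x ∂nu‖ := by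
    gcongr
  linarith

lemma lemA {q : ℝ → ℂ} (hq : q ∈ QCset) (hv : ∀ ξ, InM0 QCset 0 ξ → ξ q = 0) :
    Tendsto (fun r => PI q r) (𝓝[<] 1) (𝓝 0) := by
  by_contra hcon
  rw [Metric.tendsto_nhds] at hcon
  push Not at hcon
  obtain ⟨ε, hε, hfr⟩ := hcon
  have hne : (𝓝[<] (1 : ℝ) ⊓ 𝓟 {r | ¬ dist (PI q r) 0 < ε}).NeBot :=
    frequently_mem_iff_neBot.1 (by simpa using hfr)
  set U := Ultrafilter.of (𝓝[<] (1 : ℝ) ⊓ 𝓟 {r | ¬ dist (PI q r) 0 < ε}) with hU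
  have hU0 : (U : Filter ℝ) ≤ 𝓝[<] 1 ⊓ 𝓟 {r | ¬ dist (PI q r) 0 < ε} := Ultrafilter.of_le _
  have hU1 : (U : Filter ℝ) ≤ 𝓝[<] 1 := hU0.trans inf_le_left
  have hU2 : ∀ᶠ r in (U : Filter ℝ), ¬ dist (PI q r) 0 < ε :=
    hU0.trans inf_le_right (mem_principal_self _)
  have lim : ∀ f, BM f → Tendsto (fun r => PI f r) U (𝓝 (limUnder U (fun r => PI f r))) := by
    intro f hf
    apply tendsto_nhds_limUnder
    obtain ⟨C, hC⟩ := PI_bd hf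
    obtain ⟨l, _, hl⟩ := (isCompact_closedBall (0 : ℂ) C).ultrafilter_le_nhds
      (U.map (fun r => PI f r)) (by
        rw [le_principal_iff]
        have : ∀ᶠ r in (U : Filter ℝ), PI f r ∈ Metric.closedBall (0 : ℂ) C := by
          filter_upwards [hU1 ev01] with r hr
          simpa using hC r hr
        exact this)
    exact ⟨l, hl⟩
  set ξ : (ℝ → ℂ) → ℂ := fun f => limUnder U (fun r => PI f r) with hξ
  have uniq : ∀ f l, BM f → Tendsto (fun r => PI f r) U (𝓝 l) → ξ f = l :=
    fun f l hf hl => tendsto_nhds_unique (lim f hf) hl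
  have qb : ∀ f, f ∈ QCset → BM f := fun f hf => (QC_iff.1 hf).1.bm
  have hev : ∀ᶠ r in (U : Filter ℝ), 0 < r ∧ r < 1 := hU1 ev01
  have hM0 : InM0 QCset 0 ξ := by
    refine ⟨⟨?_, ?_, ?_, ?_, ?_⟩, ?_⟩
    · intro f hf g hg
      refine uniq _ _ ((qb f hf).add (qb g hg)) (((lim f (qb f hf)).add (lim g (qb g hg))).congr' ?_)
      filter_upwards [hev] with r hr
      exact (PI_add hr.1.le hr.2 (qb f hf) (qb g hg)).symm
    · intro f hf g hg
      refine uniq _ _ ((qb f hf).mul (qb g hg)) ?_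
      have h3 := ((PI_asym (QC_iff.1 hf).1 (QC_iff.1 hg).1).mono_left hU1).add
        ((lim f (qb f hf)).mul (lim g (qb g hg)))
      simp only [sub_add_cancel, zero_add] at h3
      exact h3
    · intro c f hf
      refine uniq _ _ ((BM.const c).mul (qb f hf)) (((lim f (qb f hf)).const_mul c).congr fun r => ?_)
      exact (PI_smul c f).symm
    · refine uniq _ _ (BM.const 1) (Tendsto.congr' (f₁ := fun _ => (1 : ℂ)) ?_ tendsto_const_nhds)
      filter_upwards [hev] with r hr
      exact (PI_const hr.1.le hr.2 1).symm
    · intro f hf C hC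
      refine le_of_tendsto (lim f (qb f hf)).norm ?_
      filter_upwards [hev] with r hr
      exact PI_bound hr.1.le hr.2 (qb f hf).1 hC
    · intro qs hqs ε hε
      have : ∀ f ∈ {f | f ∈ qs}, ∀ᶠ r in (U : Filter ℝ), ‖ξ f - movAvg f (π / (1 - r)) 0‖ < ε := by
        intro f hf
        have h3 := ((movAvg_PI (hqs f hf)).mono_left hU1).add (lim f (qb f (hqs f hf)))
        simp only [sub_add_cancel, zero_add] at h3
        filter_upwards [Metric.tendsto_nhds.1 h3 ε hε] with r hr
        rw [dist_comm, dist_eq_norm] at hr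
        exact hr
      have h4 := (eventually_all_finite (List.finite_toSet qs)).2 this
      obtain ⟨r, hr, hr1⟩ := (h4.and hev).exists
      refine ⟨π / (1 - r), ?_, hr⟩
      rw [le_div_iff₀ (by linarith)]
      have := Real.pi_gt_three; linarith
  have h0 := hv ξ hM0
  have h5 := lim q (qb q hq)
  have h6 : limUnder (U : Filter ℝ) (fun r => PI q r) = 0 := h0
  rw [h6] at h5
  obtain ⟨r, hr1, hr2⟩ := ((Metric.tendsto_nhds.1 h5 ε hε).and hU2).exists
  exact hr2 hr1


/-- the sawtooth function -/
def chi (x : ℝ) : ℝ := ∫ r, kap r x ∂rho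

lemma den_eq2 (r x : ℝ) : den r x = (r - Real.cos x) ^ 2 + Real.sin x ^ 2 := by
  unfold den; nlinarith [Real.sin_sq_add_cos_sq x]

lemma den_nonneg (r x : ℝ) : 0 ≤ den r x := by rw [den_eq2]; positivity

lemma den_cont : Continuous (fun z : ℝ × ℝ => den z.1 z.2) := by unfold den; fun_prop

lemma kap_meas : Measurable (fun z : ℝ × ℝ => kap z.1 z.2) := by
  unfold kap
  exact (by fun_prop : Continuous (fun z : ℝ × ℝ => 2 * Real.sin z.2)).measurable.div den_cont.measurable

lemma pois_meas : Measurable (fun z : ℝ × ℝ => pois z.1 z.2) := by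
  unfold pois
  exact (by fun_prop : Continuous (fun z : ℝ × ℝ => 1 - z.1 ^ 2)).measurable.div den_cont.measurable

instance rho_sf : IsFiniteMeasure rho := inferInstance

lemma kap_cont_r {x : ℝ} (hx : Real.sin x ≠ 0) : Continuous (fun r => kap r x) := by
  unfold kap
  refine continuous_const.div (by unfold den; fun_prop) fun r => ?_
  rw [den_eq2]; positivity

lemma kap_int_r (x : ℝ) : Integrable (fun r => kap r x) rho := by
  by_cases hx : Real.sin x = 0
  · simp [kap, hx]
  · exact ((kap_cont_r hx).integrableOn_Icc (a := 0) (b := 1)).mono_set Set.Ioc_subset_Icc_self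

lemma kap_int_c (x : ℝ) : Integrable (fun r => (kap r x : ℂ)) rho := (kap_int_r x).ofReal

lemma chi_arctan {x : ℝ} (hx : Real.sin x ≠ 0) :
    chi x = 2 * Real.arctan ((1 - Real.cos x) / Real.sin x) - 2 * Real.arctan ((0 - Real.cos x) / Real.sin x) := by
  rw [chi, rho_int]
  apply intervalIntegral.integral_eq_sub_of_hasDerivAt (f := fun r => 2 * Real.arctan ((r - Real.cos x) / Real.sin x))
  · intro r _
    have h1 : HasDerivAt (fun r => (r - Real.cos x) / Real.sin x) (1 / Real.sin x) r :=
      ((hasDerivAt_id r).sub_const _).div_const _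
    have h2 := (h1.arctan).const_mul 2
    refine h2.congr_deriv ?_
    change _ = 2 * Real.sin x / den r x
    rw [den_eq2]
    have : (r - Real.cos x) ^ 2 + Real.sin x ^ 2 ≠ 0 := by positivity
    field_simp
    ring
  · exact (kap_cont_r hx).intervalIntegrable _ _

lemma chi_abs (x : ℝ) : ∫ r, |kap r x| ∂rho ≤ 2 * π := by
  by_cases hx : Real.sin x = 0
  · simp [kap, hx, Real.pi_pos.le]
  have hb : |chi x| ≤ 2 * π := by
    rw [chi_arctan hx, abs_le]
    have a1 := Real.arctan_lt_pi_div_two ((1 - Real.cos x) / Real.sin x)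
    have a2 := Real.neg_pi_div_two_lt_arctan ((1 - Real.cos x) / Real.sin x)
    have a3 := Real.arctan_lt_pi_div_two ((0 - Real.cos x) / Real.sin x)
    have a4 := Real.neg_pi_div_two_lt_arctan ((0 - Real.cos x) / Real.sin x)
    constructor <;> linarith
  rcases le_or_gt 0 (Real.sin x) with h | h
  · have e : ∀ r, |kap r x| = kap r x := fun r => by
      apply abs_of_nonneg; unfold kap; exact div_nonneg (by linarith) (den_nonneg _ _)
    simp only [e]
    exact (le_abs_self _).trans hb
  · have e : ∀ r, |kap r x| = - kap r x := fun r => by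
      apply abs_of_nonpos; unfold kap; exact div_nonpos_of_nonpos_of_nonneg (by linarith) (den_nonneg _ _)
    simp only [e]
    rw [integral_neg]
    exact (neg_le_abs _).trans hb

lemma chi_bd (x : ℝ) : |chi x| ≤ 2 * π := (abs_integral_le_integral_abs).trans (chi_abs x)

lemma chi_per : Function.Periodic chi (2 * π) := by
  intro x; simp only [chi, kap_per _ x]

lemma chi_odd (x : ℝ) : chi (-x) = - chi x := by
  unfold chi; rw [← integral_neg]; congr 1; ext r; simp [kap, den]; ring

lemma chi_meas : Measurable chi := by
  have : StronglyMeasurable (Function.uncurry fun x r => kap r x) :=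
    (kap_meas.comp measurable_swap).stronglyMeasurable
  exact (this.integral_prod_right (ν := rho)).measurable

lemma chi_half {x : ℝ} (h0 : 0 < x) (h1 : x < π) : chi x = π - x := by
  have hs := Real.sin_pos_of_pos_of_lt_pi h0 h1
  rw [chi_arctan hs.ne']
  have e1 : (1 - Real.cos x) / Real.sin x = Real.tan (x / 2) := by
    have c : 0 < Real.cos (x / 2) := Real.cos_pos_of_mem_Ioo ⟨by linarith, by linarith⟩
    have s : 0 < Real.sin (x / 2) := Real.sin_pos_of_pos_of_lt_pi (by linarith) (by linarith)
    have hx : x = 2 * (x / 2) := by ring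
    rw [Real.tan_eq_sin_div_cos]
    nth_rewrite 1 [hx]
    nth_rewrite 2 [hx]
    rw [Real.sin_two_mul, Real.cos_two_mul, Real.cos_sq']
    field_simp
    ring
  have e2 : (0 - Real.cos x) / Real.sin x = Real.tan (x - π / 2) := by
    rw [Real.tan_eq_sin_div_cos, Real.sin_sub_pi_div_two, Real.cos_sub_pi_div_two, zero_sub]
  rw [e1, e2, Real.arctan_tan (by linarith) (by linarith), Real.arctan_tan (by linarith) (by linarith)]
  ring

lemma chi_eq {x : ℝ} (h0 : 0 < x) (h1 : x < 2 * π) : chi x = π - x := by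
  rcases lt_trichotomy x π with h | h | h
  · exact chi_half h0 h
  · subst h; simp [chi, kap]
  · have h2 := chi_half (x := 2 * π - x) (by linarith) (by linarith)
    have h3 : chi (2 * π - x) = - chi x := by
      rw [← chi_odd x, ← chi_per (-x)]; congr 1; ring
    linarith

lemma off_lattice {x : ℝ} (hx : ¬ ∃ n : ℤ, x = 2 * π * n) :
    ∃ n : ℤ, 0 < x - n * (2 * π) ∧ x - n * (2 * π) < 2 * π := by
  refine ⟨toIcoDiv two_pi_pos' 0 x, ?_⟩
  have := sub_toIcoDiv_zsmul_mem_Ico two_pi_pos' 0 x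
  rw [zsmul_eq_mul] at this
  refine ⟨lt_of_le_of_ne this.1 fun h => hx ⟨toIcoDiv two_pi_pos' 0 x, by linarith⟩, ?_⟩
  have := this.2; linarith

lemma chi_contAt {x : ℝ} (hx : ¬ ∃ n : ℤ, x = 2 * π * n) : ContinuousAt chi x := by
  obtain ⟨n, h0, h1⟩ := off_lattice hx
  have h2 : ContinuousAt (fun y => π - (y - n * (2 * π))) x := by fun_prop
  refine h2.congr ?_
  have o : IsOpen {y : ℝ | 0 < y - n * (2 * π) ∧ y - n * (2 * π) < 2 * π} :=
    IsOpen.inter (isOpen_lt (f := fun _ : ℝ => (0 : ℝ)) (g := fun y : ℝ => y - n * (2 * π)) (by fun_prop) (by fun_prop))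
      (isOpen_lt (g := fun _ : ℝ => 2 * π) (f := fun y : ℝ => y - n * (2 * π)) (by fun_prop) (by fun_prop))
  filter_upwards [o.mem_nhds ⟨h0, h1⟩] with y hy
  rw [← chi_eq hy.1 hy.2, chi_per.sub_int_mul_eq]

lemma chi_right : Tendsto chi (𝓝[>] 0) (𝓝 π) := by
  have h2 : Tendsto (fun y : ℝ => π - y) (𝓝[>] 0) (𝓝 (π - 0)) :=
    ((continuous_const.sub continuous_id).tendsto 0).mono_left nhdsWithin_le_nhds
  rw [sub_zero] at h2
  refine h2.congr' ?_
  filter_upwards [Ioo_mem_nhdsGT two_pi_pos'] with y hy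
  exact (chi_eq hy.1 hy.2).symm

lemma chi_left : Tendsto chi (𝓝[<] 0) (𝓝 (-π)) := by
  have h2 : Tendsto (fun y : ℝ => -(π - (-y))) (𝓝[<] 0) (𝓝 (-(π - (-0)))) :=
    ((by fun_prop : Continuous (fun y : ℝ => -(π - (-y)))).tendsto 0).mono_left nhdsWithin_le_nhds
  rw [neg_zero, sub_zero] at h2
  refine h2.congr' ?_
  filter_upwards [Ioo_mem_nhdsLT (show -(2 * π) < 0 by linarith [two_pi_pos'])] with y hy
  have := chi_eq (x := -y) (by linarith [hy.2]) (by linarith [hy.1])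
  rw [chi_odd] at this; linarith

lemma rho_ae : ∀ᵐ r ∂rho, 0 < r ∧ r < 1 := by
  rw [rho, ← Measure.restrict_congr_set Ioo_ae_eq_Ioc]
  exact ae_restrict_mem measurableSet_Ioo

lemma chi_bm : BM (fun x => (chi x : ℂ)) :=
  ⟨Complex.measurable_ofReal.comp chi_meas, 2 * π, fun x => by simpa using chi_bd x⟩

lemma kap_cont_x {r : ℝ} (h : 0 < r ∧ r < 1) : Continuous (fun x => kap r x) := by
  unfold kap
  exact (by fun_prop : Continuous fun x => 2 * Real.sin x).div (by unfold den; fun_prop)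
    fun x => (den_pos h.1.le h.2 x).ne'

lemma Gkap_int {G : ℝ → ℂ} (hG : BM G) (x : ℝ) : Integrable (fun r => G r * (kap r x : ℂ)) rho := by
  obtain ⟨m, C, hC⟩ := hG
  exact (kap_int_c x).bdd_mul m.aestronglyMeasurable (Eventually.of_forall hC)

lemma Gkap_bd {G : ℝ → ℂ} {C : ℝ} (hC : ∀ r, ‖G r‖ ≤ C) (x : ℝ) :
    ‖∫ r, G r * (kap r x : ℂ) ∂rho‖ ≤ C * (2 * π) := by
  have hC0 : 0 ≤ C := (norm_nonneg _).trans (hC 0)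
  calc _ ≤ ∫ r, C * |kap r x| ∂rho := by
        apply norm_integral_le_of_norm_le ((kap_int_r x).abs.const_mul C)
        refine Eventually.of_forall fun r => ?_
        rw [norm_mul, Complex.norm_real, Real.norm_eq_abs]
        exact mul_le_mul_of_nonneg_right (hC r) (abs_nonneg _)
    _ = C * ∫ r, |kap r x| ∂rho := integral_const_mul _ _
    _ ≤ _ := mul_le_mul_of_nonneg_left (chi_abs x) hC0

lemma K_cont {G : ℝ → ℂ} (hG : BM G) (h1 : ∀ r, 1 ≤ r → G r = 0) (hl : Tendsto G (𝓝[<] 1) (𝓝 0)) :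
    Continuous (fun x => ∫ r, G r * (kap r x : ℂ) ∂rho) := by
  obtain ⟨m, C, hC⟩ := id hG
  have hC0 : 0 ≤ C := (norm_nonneg _).trans (hC 0)
  apply continuous_of_uniform_approx_of_continuous
  intro u hu
  obtain ⟨ε, hε, hεu⟩ := Metric.mem_uniformity_dist.1 hu
  have hpi := Real.pi_pos
  obtain ⟨R, hR, hRG⟩ : ∃ R < 1, ∀ r, R < r → ‖G r‖ ≤ ε / (4 * π) := by
    have := Metric.tendsto_nhds.1 hl (ε / (4 * π)) (by positivity)
    obtain ⟨R, hR, hs⟩ := mem_nhdsLT_iff_exists_Ioo_subset.1 this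
    refine ⟨R, hR, fun r hr => ?_⟩
    rcases lt_or_ge r 1 with h | h
    · have := hs ⟨hr, h⟩
      simp only [Set.mem_ofPred_eq, dist_zero_right] at this
      exact this.le
    · rw [h1 r h, norm_zero]; positivity
  set G1 : ℝ → ℂ := (Set.Iic R).indicator G with hG1
  have hG1b : BM G1 := ⟨m.indicator measurableSet_Iic, C, fun x =>
    (norm_indicator_le_norm_self _ _).trans (hC x)⟩
  refine ⟨fun x => ∫ r, G1 r * (kap r x : ℂ) ∂rho, ?_, fun x => hεu ?_⟩
  · apply continuous_of_dominated (bound := fun _ => C * (2 / (1 - R) ^ 2))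
    · intro x
      exact (Gkap_int hG1b x).aestronglyMeasurable
    · intro x
      filter_upwards [rho_ae] with r hr
      by_cases hrR : r ≤ R
      · rw [norm_mul, Complex.norm_real]
        refine mul_le_mul ((norm_indicator_le_norm_self _ _).trans (hC r)) ?_ (norm_nonneg _) hC0
        rw [kap, norm_div, Real.norm_of_nonneg (den_nonneg r x)]
        have hp : 0 < (1 - R) ^ 2 := by have : 0 < 1 - R := by linarith
                                        positivity
        apply div_le_div₀ (by norm_num) _ hp
        · refine le_trans ?_ (den_lower hr.1.le x)
          exact pow_le_pow_left₀ (by linarith) (by linarith) 2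
        · rw [norm_mul, Real.norm_eq_abs (Real.sin x)]
          have := Real.abs_sin_le_one x
          norm_num; linarith
      · have : G1 r = 0 := Set.indicator_of_notMem (by simpa using hrR) _
        rw [this, zero_mul, norm_zero]; positivity
    · exact integrable_const _
    · filter_upwards [rho_ae] with r hr
      exact continuous_const.mul (Complex.continuous_ofReal.comp (kap_cont_x hr))
  · rw [dist_eq_norm, ← integral_sub (Gkap_int hG x) (Gkap_int hG1b x)]
    simp only [← sub_mul]
    refine (Gkap_bd (G := fun r => G r - G1 r) (C := ε / (4 * π)) (fun r => ?_) x).trans_lt ?_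
    · by_cases hrR : r ≤ R
      · have : G1 r = G r := Set.indicator_of_mem (by simpa using hrR) _
        rw [this, sub_self, norm_zero]; positivity
      · have : G1 r = 0 := Set.indicator_of_notMem (by simpa using hrR) _
        rw [this, sub_zero]; exact hRG r (not_le.1 hrR)
    · rw [show ε / (4 * π) * (2 * π) = ε / 2 by field_simp; ring]; linarith

lemma kap_prod : Integrable (fun z : ℝ × ℝ => (kap z.2 z.1 : ℂ)) (nu.prod rho) := by
  have hq0 : Measurable (fun z : ℝ × ℝ => kap z.2 z.1) :=
    kap_meas.comp (f := fun z : ℝ × ℝ => (z.2, z.1)) measurable_swap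
  have hm : Measurable (fun z : ℝ × ℝ => (kap z.2 z.1 : ℂ)) :=
    Complex.measurable_ofReal.comp (hq0 : Measurable (fun z : ℝ × ℝ => kap z.2 z.1))
  rw [integrable_prod_iff hm.aestronglyMeasurable]
  have h1 : ∀ᵐ x ∂nu, Integrable (fun r => (kap r x : ℂ)) rho := Eventually.of_forall kap_int_c
  refine ⟨h1, ?_⟩
  have hm3 : StronglyMeasurable (Function.uncurry fun x r => ‖(kap r x : ℂ)‖) :=
    hm.norm.stronglyMeasurable
  have hm2 : StronglyMeasurable (fun x => ∫ r, ‖(kap r x : ℂ)‖ ∂rho) :=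
    hm3.integral_prod_right (ν := rho)
  refine Integrable.of_bound hm2.aestronglyMeasurable (2 * π) (Eventually.of_forall fun x => ?_)
  rw [Real.norm_of_nonneg (integral_nonneg fun r => norm_nonneg _)]
  simpa using chi_abs x

lemma PI_meas {h : ℝ → ℂ} (hh : Measurable h) : Measurable (PI h) := by
  have : StronglyMeasurable (Function.uncurry fun r x => h x * (pois r x : ℂ)) :=
    ((hh.comp measurable_snd).mul (Complex.measurable_ofReal.comp pois_meas)).stronglyMeasurable
  exact (this.integral_prod_right (ν := nu)).measurable

lemma chi_Hs {h : ℝ → ℂ} (hh : Hs h) (hl : Tendsto (PI h) (𝓝[<] 1) (𝓝 0)) :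
    CH (fun x => (chi x : ℂ) * h x) := by
  obtain ⟨hm, C, hC⟩ := id hh.2.1
  have hC0 : 0 ≤ C := (norm_nonneg _).trans (hC 0)
  set G : ℝ → ℂ := (Set.Ioo 0 1).indicator (PI h) with hGd
  have Gin : ∀ r, 0 < r ∧ r < 1 → G r = PI h r :=
    fun r hr => Set.indicator_of_mem (show r ∈ Set.Ioo (0 : ℝ) 1 from hr) _
  have hG : BM G := ⟨(PI_meas hm).indicator measurableSet_Ioo, C, fun r => by
    by_cases hr : r ∈ Set.Ioo (0 : ℝ) 1
    · rw [Gin r hr]; exact PI_bound hr.1.le hr.2 hm hC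
    · rw [hGd, Set.indicator_of_notMem hr, norm_zero]; exact hC0⟩
  have hGl : Tendsto G (𝓝[<] 1) (𝓝 0) := by
    refine hl.congr' ?_
    filter_upwards [ev01] with r hr using (Gin r hr).symm
  have hK := K_cont hG (fun r hr => Set.indicator_of_notMem (fun h => absurd h.2 (not_lt.2 hr)) _) hGl
  set K : ℝ → ℂ := fun x => ∫ r, G r * (kap r x : ℂ) ∂rho with hKd
  have Kc : K ∈ CtsT := ⟨fun x => by simp only [hKd, kap_per _ x], hK⟩
  refine ⟨K, Kc, fun x => (chi x : ℂ) * h x - K x, ⟨?_, ?_, ?_⟩, ?_⟩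
  · intro x; simp only [chi_per x, hh.1 x, Kc.1 x]
  · exact (chi_bm.mul hh.2.1).sub (cts_bdd Kc)
  · intro m hm1
    have e : ∀ x, ((chi x : ℂ) * h x - K x) * zz x ^ m
        = ∫ r, (h x - G r) * kap r x * zz x ^ m ∂rho := by
      intro x
      rw [integral_mul_const]
      congr 1
      simp only [sub_mul]
      rw [integral_sub ((kap_int_c x).const_mul (h x)) (Gkap_int hG x),
        integral_const_mul, chi, ← integral_complex_ofReal, mul_comm]
    simp only [e]
    have hIntgr : Integrable (Function.uncurry fun x r => (h x - G r) * (kap r x : ℂ) * zz x ^ m)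
        (nu.prod rho) := by
      obtain ⟨gm, D, hD⟩ := hG
      have m1 : Measurable (fun z : ℝ × ℝ => (h z.1 - G z.2) * zz z.1 ^ m) :=
        ((hm.comp measurable_fst).sub (gm.comp measurable_snd)).mul
          ((zz_cont.pow m).measurable.comp measurable_fst)
      have := kap_prod.bdd_mul (c := C + D) m1.aestronglyMeasurable (Eventually.of_forall fun z => by
        rw [norm_mul, norm_pow, zz_norm, one_pow, mul_one]
        exact (norm_sub_le _ _).trans (add_le_add (hC _) (hD _)))
      refine this.congr (Eventually.of_forall fun z => ?_)
      simp only [Function.uncurry]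
      ring
    rw [integral_integral_swap hIntgr]
    apply integral_eq_zero_of_ae
    filter_upwards [rho_ae] with r hr
    rw [Gin r hr]
    exact int_k hr.1.le hr.2 hh m hm1
  · ext x; simp

lemma chi_Cts {c : ℝ → ℂ} (hc : c ∈ CtsT) (h0 : c 0 = 0) : (fun x => (chi x : ℂ) * c x) ∈ CtsT := by
  refine ⟨fun x => by simp only [chi_per x, hc.1 x], continuous_iff_continuousAt.2 fun x => ?_⟩
  by_cases hx : ∃ n : ℤ, x = 2 * π * n
  · have cx : c x = 0 := by
      obtain ⟨n, rfl⟩ := hx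
      have := hc.1.int_mul n 0
      rw [zero_add, mul_comm, h0] at this; exact this
    have T : Tendsto (fun y => (2 * π) * ‖c y‖) (𝓝 x) (𝓝 0) := by
      have := (hc.2.norm.tendsto x).const_mul (2 * π)
      simpa [cx] using this
    have e0 : (fun x => (chi x : ℂ) * c x) x = 0 := by simp only [cx, mul_zero]
    unfold ContinuousAt
    rw [e0]
    refine squeeze_zero_norm (fun y => ?_) T
    rw [norm_mul, Complex.norm_real]
    exact mul_le_mul_of_nonneg_right (chi_bd y) (norm_nonneg _)
  · exact (Complex.continuous_ofReal.continuousAt.comp (chi_contAt hx)).mul hc.2.continuousAt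

lemma chi_CH {q : ℝ → ℂ} (hq : CH q) (hl : Tendsto (PI q) (𝓝[<] 1) (𝓝 0)) :
    CH (fun x => (chi x : ℂ) * q x) := by
  obtain ⟨c, hc, c0, h, hh, rfl⟩ := hq.nf
  have hl2 : Tendsto (PI h) (𝓝[<] 1) (𝓝 0) := by
    have := hl.sub (PI_small1 hc c0)
    rw [sub_zero] at this
    refine this.congr' ?_
    filter_upwards [ev01] with r hr
    rw [PI_add hr.1.le hr.2 (cts_bdd hc) hh.2.1]; ring
  have := (CtsT.ch (chi_Cts hc c0)).add (chi_Hs hh hl2)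
  simpa [mul_add] using this


/-- smoothing operator -/
def Sm (δ : ℝ) (f : ℝ → ℂ) (x : ℝ) : ℂ := ∫ t, f (x + δ * t) ∂rho

lemma Sm_cont {δ : ℝ} (hδ : δ ≠ 0) {f : ℝ → ℂ} (hf : BM f) : Continuous (Sm δ f) := by
  have e : Sm δ f = fun x => δ⁻¹ • ((∫ y in (0 : ℝ)..(x + δ), f y) - ∫ y in (0 : ℝ)..x, f y) := by
    ext x
    rw [Sm, rho_int, intervalIntegral.integral_comp_add_mul f hδ x, mul_zero, mul_one, add_zero,
      intervalIntegral.integral_interval_sub_left (hf.ii _ _) (hf.ii _ _)]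
  have hc : Continuous fun x => ∫ y in (0 : ℝ)..x, f y :=
    intervalIntegral.continuous_primitive (fun a b => hf.ii a b) 0
  rw [e]
  have h2 : Continuous fun x => (∫ y in (0 : ℝ)..(x + δ), f y) - ∫ y in (0 : ℝ)..x, f y :=
    (hc.comp (continuous_id.add continuous_const)).sub hc
  exact h2.const_smul (δ⁻¹)

lemma comp_bm {f : ℝ → ℂ} (hf : BM f) (δ x : ℝ) : BM (fun t => f (x + δ * t)) := by
  obtain ⟨m, C, hC⟩ := hf
  exact ⟨m.comp (by fun_prop), C, fun t => hC _⟩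

lemma Sm_bd {δ : ℝ} {f : ℝ → ℂ} {C : ℝ} (hC : ∀ x, ‖f x‖ ≤ C) (x : ℝ) : ‖Sm δ f x‖ ≤ C := by
  have := norm_integral_le_of_norm_le_const (μ := rho) (f := fun t => f (x + δ * t)) (C := C)
    (Eventually.of_forall fun t => hC _)
  simpa [Sm] using this

lemma Sm_per {δ : ℝ} {f : ℝ → ℂ} (hf : Function.Periodic f (2 * π)) :
    Function.Periodic (Sm δ f) (2 * π) := by
  intro x
  unfold Sm
  congr 1; ext t
  rw [show x + 2 * π + δ * t = x + δ * t + 2 * π by ring, hf]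

lemma Sm_Cts {δ : ℝ} (hδ : δ ≠ 0) {f : ℝ → ℂ} (hp : Function.Periodic f (2 * π)) (hf : BM f) :
    Sm δ f ∈ CtsT := ⟨Sm_per hp, Sm_cont hδ hf⟩

lemma Sm_add {δ : ℝ} {f g : ℝ → ℂ} (hf : BM f) (hg : BM g) (x : ℝ) :
    Sm δ (fun x => f x + g x) x = Sm δ f x + Sm δ g x :=
  integral_add ((comp_bm hf δ x).int _) ((comp_bm hg δ x).int _)

lemma Sm_Hs {δ : ℝ} (hδ : δ ≠ 0) {f : ℝ → ℂ} (hf : Hs f) : Hs (Sm δ f) := by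
  have hc := Sm_Cts hδ hf.1 hf.2.1
  refine ⟨hc.1, cts_bdd hc, fun m hm => ?_⟩
  have e : ∀ x, Sm δ f x * zz x ^ m = ∫ t, f (x + δ * t) * zz x ^ m ∂rho := fun x =>
    (integral_mul_const _ _).symm
  simp only [e]
  obtain ⟨fm, C, hC⟩ := id hf.2.1
  have hIntgr : Integrable (Function.uncurry fun x t => f (x + δ * t) * zz x ^ m) (nu.prod rho) := by
    have h1 : Measurable (fun z : ℝ × ℝ => f (z.1 + δ * z.2)) := fm.comp (by fun_prop)
    have h2 : Measurable (fun z : ℝ × ℝ => zz z.1 ^ m) := (zz_cont.pow m).measurable.comp measurable_fst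
    refine Integrable.of_bound (h1.mul h2).aestronglyMeasurable C (Eventually.of_forall fun z => ?_)
    change ‖f (z.1 + δ * z.2) * zz z.1 ^ m‖ ≤ C
    rw [norm_mul, norm_pow, zz_norm, one_pow, mul_one]; exact hC _
  rw [integral_integral_swap hIntgr]
  apply integral_eq_zero_of_ae
  refine Eventually.of_forall fun t => ?_
  have e2 : ∀ x, f (x + δ * t) * zz x ^ m
      = ((zz (δ * t)) ^ m)⁻¹ * (f (x + δ * t) * zz (x + δ * t) ^ m) := by
    intro x
    have := pow_ne_zero m (zz_ne (δ * t))
    rw [zz_add, mul_pow]; field_simp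
  simp only [e2, Pi.zero_apply]
  rw [integral_const_mul]
  have h3 := nu_shift (f := fun x => f x * zz x ^ m)
    (fun x => by simp only [hf.1 x, zz_per x]) (δ * t)
  rw [h3, hf.2.2 m hm, mul_zero]

lemma Sm_unif {c : ℝ → ℂ} (hc : c ∈ CtsT) {ε : ℝ} (hε : 0 < ε) :
    ∃ δ : ℝ, 0 < δ ∧ ∀ x, ‖c x - Sm δ c x‖ ≤ ε := by
  have hu := (isCompact_Icc (a := (0 : ℝ)) (b := 2 * π + 1)).uniformContinuousOn_of_continuous
    hc.2.continuousOn
  obtain ⟨d, hd, hdc⟩ := Metric.uniformContinuousOn_iff.1 hu ε hε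
  set δ := min (d / 2) 1 with hδ
  have hδ0 : 0 < δ := lt_min (by linarith) one_pos
  have hδ1 : δ ≤ 1 := min_le_right _ _
  have hδd : δ ≤ d / 2 := min_le_left _ _
  refine ⟨δ, hδ0, fun x => ?_⟩
  have key : ∀ y ∈ Set.Ico 0 (2 * π), ‖c y - Sm δ c y‖ ≤ ε := by
    intro y hy
    have e : c y - Sm δ c y = ∫ t, (c y - c (y + δ * t)) ∂rho := by
      rw [integral_sub (integrable_const _) ((comp_bm (cts_bdd hc) δ y).int _)]
      simp [Sm]
    rw [e]
    have := norm_integral_le_of_norm_le_const (μ := rho) (f := fun t => c y - c (y + δ * t)) (C := ε) (by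
      filter_upwards [rho_ae] with t ht
      have h1 : 0 ≤ δ * t := mul_nonneg hδ0.le ht.1.le
      have h2 : δ * t ≤ δ := by nlinarith [ht.2]
      rw [← dist_eq_norm]
      refine (hdc y ⟨hy.1, by linarith [hy.2]⟩ _ ⟨by linarith [hy.1], by linarith [hy.2]⟩ ?_).le
      rw [Real.dist_eq, show y - (y + δ * t) = -(δ * t) by ring, abs_neg, abs_of_nonneg h1]
      linarith)
    simpa using this
  have hper : Function.Periodic (fun x => ‖c x - Sm δ c x‖) (2 * π) := fun x => by
    simp only [hc.1 x, Sm_per hc.1 x]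
  obtain ⟨y, hy, hxy⟩ := hper.exists_mem_Ico₀ two_pi_pos' x
  exact hxy.le.trans (key y hy)

lemma CH.ctrl {d : ℝ → ℂ} (hd : CH d) {M ε : ℝ} (hM : ∀ x, ‖d x‖ ≤ M) (hε : 0 < ε) :
    ∃ c ∈ CtsT, (∃ h, Hs h ∧ ∀ x, d x = c x + h x) ∧ ∀ x, ‖c x‖ ≤ M + ε := by
  have db := hd.bm
  have dp := hd.per
  obtain ⟨c, hc, h, hh, e⟩ := hd
  obtain ⟨δ, hδ, hu⟩ := Sm_unif hc hε
  refine ⟨_, CtsT.add (Sm_Cts hδ.ne' dp db) (CtsT.sub hc (Sm_Cts hδ.ne' hc.1 (cts_bdd hc))),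
    ⟨_, hh.sub (Sm_Hs hδ.ne' hh), fun x => ?_⟩, fun x => ?_⟩
  · have : Sm δ d x = Sm δ c x + Sm δ h x := by
      rw [← Sm_add (cts_bdd hc) hh.2.1, e]; rfl
    rw [this]
    have : d x = c x + h x := by rw [e]; rfl
    rw [this]; ring
  · exact (norm_add_le _ _).trans (add_le_add (Sm_bd hM x) (hu x))

lemma CH.closed {f : ℝ → ℂ} (hp : Function.Periodic f (2 * π)) (hf : BM f)
    (H : ∀ ε : ℝ, 0 < ε → ∃ g, CH g ∧ ∀ x, ‖f x - g x‖ ≤ ε) : CH f := by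
  have H1 : ∀ n : ℕ, ∃ g, CH g ∧ ∀ x, ‖f x - g x‖ ≤ (1 / 2 : ℝ) ^ n := fun n => H _ (by positivity)
  choose g hg hgf using H1
  have hd : ∀ n x, ‖g (n + 1) x - g n x‖ ≤ 2 * (1 / 2 : ℝ) ^ n := by
    intro n x
    have h1 := hgf (n + 1) x
    have h2 := hgf n x
    have h3 := norm_sub_le (f x - g n x) (f x - g (n + 1) x)
    rw [sub_sub_sub_cancel_left] at h3
    rw [pow_succ] at h1
    have : (0 : ℝ) < (1 / 2 : ℝ) ^ n := by positivity
    linarith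
  have H2 : ∀ n, ∃ c ∈ CtsT, (∃ h, Hs h ∧ ∀ x, g (n + 1) x - g n x = c x + h x) ∧
      ∀ x, ‖c x‖ ≤ 2 * (1 / 2 : ℝ) ^ n + (1 / 2 : ℝ) ^ n := fun n =>
    ((hg (n + 1)).sub (hg n)).ctrl (hd n) (by positivity)
  choose c hc hch hcb using H2
  choose h hh hgh using hch
  obtain ⟨c0, hc0, h0, hh0, e0⟩ := id (hg 0)
  have sb : Summable (fun n : ℕ => 2 * (1 / 2 : ℝ) ^ n + (1 / 2 : ℝ) ^ n) :=
    (summable_geometric_two.mul_left 2).add summable_geometric_two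
  set S : ℝ → ℂ := fun x => ∑' n, c n x with hS
  have Sc : S ∈ CtsT := ⟨fun x => by simp only [hS, (hc _).1 x], continuous_tsum (fun n => (hc n).2) sb hcb⟩
  have Su : TendstoUniformly (fun N x => ∑ n ∈ Finset.range N, c n x) S atTop :=
    tendstoUniformly_tsum_nat sb hcb
  -- partial sums of analytic parts
  have HN : ∀ N : ℕ, Hs (fun x => h0 x + ∑ n ∈ Finset.range N, h n x) := by
    intro N
    induction N with
    | zero => simpa using hh0
    | succ N ih =>
      simp only [Finset.sum_range_succ, ← add_assoc]
      exact ih.add (hh N)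
  have tel : ∀ N x, g N x = (c0 x + ∑ n ∈ Finset.range N, c n x) + (h0 x + ∑ n ∈ Finset.range N, h n x) := by
    intro N x
    induction N with
    | zero => simp [e0]
    | succ N ih =>
      rw [Finset.sum_range_succ, Finset.sum_range_succ]
      have := hgh N x
      linear_combination ih + this
  have hb : BM (fun x => f x - (c0 x + S x)) := hf.sub ((cts_bdd hc0).add (cts_bdd Sc))
  refine ⟨_, CtsT.add hc0 Sc, fun x => f x - (c0 x + S x), ⟨?_, hb, fun m hm => ?_⟩, ?_⟩
  · intro x; simp only [hp x, hc0.1 x, Sc.1 x]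
  · rw [← norm_le_zero_iff]
    apply le_of_forall_pos_le_add
    intro ε hε
    rw [zero_add]
    have E1 : ∀ᶠ N : ℕ in atTop, (1 / 2 : ℝ) ^ N < ε / 2 :=
      (tendsto_pow_atTop_nhds_zero_of_lt_one (by norm_num) (by norm_num)).eventually
        (gt_mem_nhds (half_pos hε))
    obtain ⟨N, hN1, hN2⟩ := (E1.and (Metric.tendstoUniformly_iff.1 Su (ε / 2) (half_pos hε))).exists
    have e : ∫ x, (f x - (c0 x + S x)) * zz x ^ m ∂nu
        = ∫ x, ((f x - (c0 x + S x)) - (h0 x + ∑ n ∈ Finset.range N, h n x)) * zz x ^ m ∂nu := by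
      simp only [sub_mul _ _ (zz _ ^ m)]
      have i1 := (hb.mul (BM.zpow m)).int nu
      simp only [sub_mul] at i1
      rw [integral_sub i1 (((HN N).2.1.mul (BM.zpow m)).int nu), (HN N).2.2 m hm, sub_zero]
    rw [e]
    have := norm_integral_le_of_norm_le_const (μ := nu)
      (f := fun x => ((f x - (c0 x + S x)) - (h0 x + ∑ n ∈ Finset.range N, h n x)) * zz x ^ m)
      (C := ε) (Eventually.of_forall fun x => by
        rw [norm_mul, norm_pow, zz_norm, one_pow, mul_one]
        have e3 : (f x - (c0 x + S x)) - (h0 x + ∑ n ∈ Finset.range N, h n x)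
            = (f x - g N x) - (S x - ∑ n ∈ Finset.range N, c n x) := by rw [tel]; ring
        rw [e3]
        have h5 := hN2 x
        rw [dist_eq_norm] at h5
        have h6 := hgf N x
        have := norm_sub_le (f x - g N x) (S x - ∑ n ∈ Finset.range N, c n x)
        linarith)
    simpa using this
  · ext x; simp

lemma zz_Cts : zz ∈ CtsT := ⟨zz_per, zz_cont⟩
lemma zzi_Cts : (fun x => (zz x)⁻¹) ∈ CtsT :=
  ⟨fun x => by simp only [zz_per x], zz_cont.inv₀ zz_ne⟩

lemma CH.zz_mul {q : ℝ → ℂ} (hq : CH q) : CH (fun x => zz x * q x) := by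
  obtain ⟨c, hc, h, hh, rfl⟩ := hq
  have h1 : Hs (fun x => zz x * h x) := by
    refine ⟨fun x => by simp only [zz_per x, hh.1 x], (cts_bdd zz_Cts).mul hh.2.1, fun m hm => ?_⟩
    rw [← hh.2.2 (m + 1) (by omega)]
    congr 1; ext x; ring
  have := (CtsT.ch (CtsT.mul zz_Cts hc)).add h1.ch
  simpa [mul_add] using this

lemma CH.zzi_mul {q : ℝ → ℂ} (hq : CH q) : CH (fun x => (zz x)⁻¹ * q x) := by
  obtain ⟨c, hc, h, hh, rfl⟩ := hq
  set a : ℂ := ∫ x, h x ∂nu with ha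
  have h1 : Hs (fun x => (zz x)⁻¹ * (h x - a)) := by
    refine ⟨fun x => by simp only [zz_per x, hh.1 x],
      (cts_bdd zzi_Cts).mul (hh.2.1.sub (BM.const a)), fun m hm => ?_⟩
    obtain ⟨k, rfl⟩ : ∃ k, m = k + 1 := ⟨m - 1, by omega⟩
    have e : ∀ x, (zz x)⁻¹ * (h x - a) * zz x ^ (k + 1) = h x * zz x ^ k - a * zz x ^ k := by
      intro x; have := zz_ne x; rw [pow_succ]; field_simp
    simp only [e]
    rw [integral_sub ((hh.2.1.mul (BM.zpow k)).int _) (((BM.const a).mul (BM.zpow k)).int _),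
      integral_const_mul]
    rcases Nat.eq_zero_or_pos k with rfl | hk
    · simp [ha]
    · rw [hh.2.2 k hk, nu_zz k hk]; simp
  have := (CtsT.ch (CtsT.mul zzi_Cts (CtsT.add hc (CtsT.const a)))).add h1.ch
  refine (congrArg CH ?_).mp this
  ext x; simp; ring

lemma CH.zzpow_mul {q : ℝ → ℂ} (hq : CH q) (n : ℤ) : CH (fun x => zz x ^ n * q x) := by
  induction n with
  | zero => simpa using hq
  | succ n ih =>
    refine (congrArg CH ?_).mp ih.zz_mul
    ext x; rw [zpow_add_one₀ (zz_ne x)]; ring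
  | pred n ih =>
    refine (congrArg CH ?_).mp ih.zzi_mul
    ext x; rw [zpow_sub_one₀ (zz_ne x)]; ring

lemma CH.cts_mul {p q : ℝ → ℂ} (hp : p ∈ CtsT) (hq : CH q) : CH (fun x => p x * q x) := by
  obtain ⟨qm, C, hC⟩ := hq.bm
  have hC0 : 0 ≤ C := (norm_nonneg _).trans (hC 0)
  refine CH.closed (fun x => by simp only [hp.1 x, hq.per x]) ((cts_bdd hp).mul hq.bm) fun ε hε => ?_
  have : Fact (0 < 2 * π) := ⟨two_pi_pos'⟩
  have hlc : Continuous (hp.1.lift) := by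
    exact continuous_coinduced_dom.2 hp.2
  let P : C(AddCircle (2 * π), ℂ) := ⟨hp.1.lift, hlc⟩
  have hcl : P ∈ (Submodule.span ℂ (Set.range (@fourier (2 * π)))).topologicalClosure := by
    rw [span_fourier_closure_eq_top]; trivial
  obtain ⟨g, hg, hPg⟩ := Metric.mem_closure_iff.1 hcl (ε / (C + 1)) (by positivity)
  have hgCH : CH (fun x => g (x : AddCircle (2 * π)) * q x) := by
    refine Submodule.span_induction (p := fun g _ => CH (fun x => (g : C(AddCircle (2 * π), ℂ)) (x : AddCircle (2 * π)) * q x)) ?_ ?_ ?_ ?_ hg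
    · rintro _ ⟨n, rfl⟩
      refine (congrArg CH ?_).mp (hq.zzpow_mul n)
      ext x
      rw [fourier_coe_apply, zz, ← Complex.exp_int_mul]
      congr 2
      have : (π : ℂ) ≠ 0 := by exact_mod_cast Real.pi_ne_zero
      push_cast; field_simp
    · simpa using (Hs.const 0).ch
    · intro a b _ _ ha hb
      simpa [add_mul] using ha.add hb
    · intro a b _ hb
      simpa [mul_assoc] using hb.smul a
  refine ⟨_, hgCH, fun x => ?_⟩
  rw [← sub_mul, norm_mul]
  have h1 : ‖p x - g (x : AddCircle (2 * π))‖ ≤ ε / (C + 1) := by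
    rw [← dist_eq_norm]
    have := (ContinuousMap.dist_apply_le_dist (f := P) (g := g) (x : AddCircle (2 * π))).trans hPg.le
    exact this
  calc _ ≤ ε / (C + 1) * C := mul_le_mul h1 (hC x) (norm_nonneg _) (by positivity)
    _ ≤ ε := by
      rw [div_mul_eq_mul_div, div_le_iff₀ (by positivity)]; nlinarith


lemma lat_iff (x : ℝ) : (∃ n : ℤ, x = 2 * π * n) ↔ Real.sin (x / 2) = 0 := by
  rw [Real.sin_eq_zero_iff]
  constructor
  · rintro ⟨n, rfl⟩; exact ⟨n, by ring⟩
  · rintro ⟨n, hn⟩; exact ⟨n, by linarith⟩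

/-- the lattice of angles of the point one -/
def lat : Set ℝ := {x | Real.sin (x / 2) = 0}

lemma mem_lat {x : ℝ} : x ∈ lat ↔ ∃ n : ℤ, x = 2 * π * n := (lat_iff x).symm

lemma lat_closed : IsClosed lat := isClosed_eq (by fun_prop) continuous_const

lemma lat_per (x : ℝ) : x + 2 * π ∈ lat ↔ x ∈ lat := by
  simp only [mem_lat]
  constructor
  · rintro ⟨n, hn⟩; exact ⟨n - 1, by push_cast; linarith⟩
  · rintro ⟨n, hn⟩; exact ⟨n + 1, by push_cast; linarith⟩

lemma zero_lat : (0 : ℝ) ∈ lat := mem_lat.2 ⟨0, by simp⟩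

lemma lat_null : ∀ᵐ x ∂nu, x ∉ lat := by
  have hc : lat.Countable := by
    have : lat = Set.range (fun n : ℤ => 2 * π * n) := by
      ext x; rw [mem_lat]; simp [eq_comm]
    rw [this]; exact Set.countable_range _
  have h1 : ∀ᵐ x ∂(volume.restrict (Set.Ioc 0 (2 * π))), x ∉ lat := hc.ae_notMem _
  unfold nu
  exact Measure.ae_smul_measure h1 _

lemma chi_lat {x : ℝ} (hx : x ∈ lat) : chi x = 0 := by
  obtain ⟨n, rfl⟩ := mem_lat.1 hx
  have : Real.sin (2 * π * n) = 0 := by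
    rw [Real.sin_eq_zero_iff]; exact ⟨2 * n, by push_cast; ring⟩
  simp [chi, kap, this]

open Classical in
lemma null_CH {q : ℝ → ℂ} (hp : Function.Periodic q (2 * π)) (hq : BM q) (a : ℂ) :
    CH (fun x => (if x ∈ lat then a else 0) * q x) := by
  refine Hs.ch ⟨fun x => by simp only [lat_per, hp x], BM.mul ⟨?_, ‖a‖, fun x => ?_⟩ hq, fun m _ => ?_⟩
  · exact Measurable.ite lat_closed.measurableSet measurable_const measurable_const
  · beta_reduce; split_ifs <;> simp
  · apply integral_eq_zero_of_ae
    filter_upwards [lat_null] with x hx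
    simp [hx]

open Classical in
lemma main0 {p q : ℝ → ℂ} (hp : Function.Periodic p (2 * π))
    (hc : ∀ x, x ∉ lat → ContinuousAt p x) {l1 l2 : ℂ} (h1 : Tendsto p (𝓝[>] 0) (𝓝 l1))
    (h2 : Tendsto p (𝓝[<] 0) (𝓝 l2)) (hq : CH q) (hl : Tendsto (PI q) (𝓝[<] 1) (𝓝 0)) :
    CH (fun x => p x * q x) := by
  have hpi : (π : ℂ) ≠ 0 := by exact_mod_cast Real.pi_ne_zero
  obtain ⟨a, ha⟩ : ∃ a, a = (l1 - l2) / (2 * π) := ⟨_, rfl⟩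
  obtain ⟨b, hb⟩ : ∃ b, b = (l1 + l2) / 2 := ⟨_, rfl⟩
  set p' : ℝ → ℂ := fun x => if x ∈ lat then b else p x - a * chi x with hp'
  have p'per : Function.Periodic p' (2 * π) := fun x => by
    simp only [hp', lat_per, hp x, chi_per x]
  have E1 : ∀ᶠ y : ℝ in 𝓝[>] 0, y ∉ lat := by
    filter_upwards [Ioo_mem_nhdsGT two_pi_pos'] with y hy h
    have : 0 < Real.sin (y / 2) :=
      Real.sin_pos_of_pos_of_lt_pi (by linarith [hy.1]) (by linarith [hy.2])
    exact this.ne' h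
  have E2 : ∀ᶠ y : ℝ in 𝓝[<] 0, y ∉ lat := by
    filter_upwards [Ioo_mem_nhdsLT (show -(2 * π) < 0 by linarith [two_pi_pos'])] with y hy h
    have : Real.sin (y / 2) < 0 :=
      Real.sin_neg_of_neg_of_neg_pi_lt (by linarith [hy.2]) (by linarith [hy.1])
    exact this.ne h
  have c0 : ContinuousAt p' 0 := by
    have v0 : p' 0 = b := by simp only [hp', if_pos zero_lat]
    rw [continuousAt_iff_continuous_left'_right']
    constructor
    · unfold ContinuousWithinAt
      rw [v0]
      have T := h2.sub (((Complex.continuous_ofReal.tendsto _).comp chi_left).const_mul a)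
      have e : l2 - a * ((-π : ℝ) : ℂ) = b := by rw [ha, hb]; push_cast; field_simp; ring
      rw [e] at T
      refine T.congr' ?_
      filter_upwards [E2] with y hy
      simp only [hp', if_neg hy, Function.comp]
    · unfold ContinuousWithinAt
      rw [v0]
      have T := h1.sub (((Complex.continuous_ofReal.tendsto _).comp chi_right).const_mul a)
      have e : l1 - a * (π : ℂ) = b := by rw [ha, hb]; field_simp; ring
      rw [e] at T
      refine T.congr' ?_
      filter_upwards [E1] with y hy
      simp only [hp', if_neg hy, Function.comp]
  have p'c : p' ∈ CtsT := by
    refine ⟨p'per, continuous_iff_continuousAt.2 fun x => ?_⟩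
    by_cases hx : x ∈ lat
    · obtain ⟨n, rfl⟩ := mem_lat.1 hx
      have e : p' = fun y => p' (y - n * (2 * π)) := by ext y; exact (p'per.sub_int_mul_eq n).symm
      rw [e]
      have h3 : ContinuousAt (fun y : ℝ => y - n * (2 * π)) (2 * π * n) := by fun_prop
      refine ContinuousAt.comp (g := p') ?_ h3
      rwa [show 2 * π * (n : ℝ) - n * (2 * π) = 0 by ring]
    · have h3 : ContinuousAt (fun x => p x - a * (chi x : ℂ)) x :=
        (hc x hx).sub (continuousAt_const.mul (Complex.continuous_ofReal.continuousAt.comp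
          (chi_contAt fun h => hx (mem_lat.2 h))))
      refine h3.congr ?_
      filter_upwards [lat_closed.isOpen_compl.mem_nhds hx] with y hy
      simp only [hp']
      rw [if_neg hy]
  have := ((chi_CH hq hl).smul a).add ((hq.cts_mul p'c).add (null_CH hq.per hq.bm (p 0 - b)))
  refine (congrArg CH ?_).mp this
  ext x
  by_cases hx : x ∈ lat
  · have px : p x = p 0 := by
      obtain ⟨n, rfl⟩ := mem_lat.1 hx
      have := hp.int_mul n 0
      rw [zero_add, mul_comm] at this; exact this
    simp only [hp', if_pos hx, chi_lat hx, px]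
    push_cast; ring
  · simp only [hp', if_neg hx]; ring

lemma Hs.shift {f : ℝ → ℂ} (hf : Hs f) (t : ℝ) : Hs (fun x => f (x + t)) := by
  refine ⟨fun x => ?_, hf.2.1.shift t, fun m hm => ?_⟩
  · change f (x + 2 * π + t) = f (x + t)
    rw [show x + 2 * π + t = x + t + 2 * π by ring, hf.1]
  · have e2 : ∀ x, f (x + t) * zz x ^ m
        = ((zz t) ^ m)⁻¹ * (f (x + t) * zz (x + t) ^ m) := by
      intro x
      have := pow_ne_zero m (zz_ne t)
      rw [zz_add, mul_pow]; field_simp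
    simp only [e2]
    rw [integral_const_mul]
    have h3 := nu_shift (f := fun x => f x * zz x ^ m)
      (fun x => by simp only [hf.1 x, zz_per x]) t
    rw [h3, hf.2.2 m hm, mul_zero]

lemma CH.shift {f : ℝ → ℂ} (hf : CH f) (t : ℝ) : CH (fun x => f (x + t)) := by
  obtain ⟨c, hc, h, hh, rfl⟩ := hf
  refine ⟨fun x => c (x + t), ⟨fun x => ?_, hc.2.comp (by fun_prop)⟩, _, hh.shift t, rfl⟩
  change c (x + 2 * π + t) = c (x + t)
  rw [show x + 2 * π + t = x + t + 2 * π by ring, hc.1]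

lemma QC_shift {f : ℝ → ℂ} (hf : f ∈ QCset) (t : ℝ) : (fun x => f (x + t)) ∈ QCset := by
  obtain ⟨h1, h2⟩ := QC_iff.1 hf
  exact QC_iff.2 ⟨h1.shift t, h2.shift t⟩

lemma movAvg_shift (f : ℝ → ℂ) (lam t : ℝ) : movAvg (fun x => f (x + t)) lam 0 = movAvg f lam t := by
  unfold movAvg
  rw [intervalIntegral.integral_comp_add_right (fun x => f x) t]
  rw [show 0 - π / lam + t = t - π / lam by ring, show 0 + π / lam + t = t + π / lam by ring]

lemma InM0_shift {ξ : (ℝ → ℂ) → ℂ} (t : ℝ) (h : InM0 QCset 0 ξ) :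
    InM0 QCset t (fun f => ξ (fun x => f (x + t))) := by
  obtain ⟨⟨h1, h2, h3, h4, h5⟩, h6⟩ := h
  refine ⟨⟨fun p hp q hq => h1 _ (QC_shift hp t) _ (QC_shift hq t),
    fun p hp q hq => h2 _ (QC_shift hp t) _ (QC_shift hq t),
    fun c q hq => h3 c _ (QC_shift hq t), h4,
    fun q hq C hC => h5 _ (QC_shift hq t) C fun x => hC _⟩, fun qs hqs ε hε => ?_⟩
  obtain ⟨lam, hl, H⟩ := h6 (qs.map fun f x => f (x + t)) (by
    intro q hq
    obtain ⟨f, hf, rfl⟩ := List.mem_map.1 hq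
    exact QC_shift (hqs f hf) t) ε hε
  refine ⟨lam, hl, fun q hq => ?_⟩
  have := H _ (List.mem_map.2 ⟨q, hq, rfl⟩)
  rwa [movAvg_shift] at this

/-- If `q ∈ QC` vanishes (as a Gelfand transform) on `M_{τ₀}^0(QC)` for `τ₀ = 1`
(angle `θ₀ = 0`) or `τ₀ = -1` (angle `θ₀ = π`), and `p ∈ PC` is continuous on `T \ {τ₀}`,
then `pq ∈ QC`. -/
theorem pc_mul_qc_in_QC (θ₀ : ℝ) (hθ₀ : θ₀ = 0 ∨ θ₀ = π)
    (q : ℝ → ℂ) (hq : q ∈ QCset)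
    (hvanish : ∀ ξ, InM0 QCset θ₀ ξ → ξ q = 0)
    (p : ℝ → ℂ) (hp : p ∈ PCset)
    (hcont : ∀ x : ℝ, (¬ ∃ n : ℤ, x = θ₀ + 2 * π * n) → ContinuousAt p x) :
    p * q ∈ QCset := by
  have hq1 := QC_shift hq θ₀
  have hl := lemA hq1 (fun ξ hξ => hvanish _ (InM0_shift θ₀ hξ))
  have hPper : Function.Periodic (fun x => p (x + θ₀)) (2 * π) := fun x => by
    change p (x + 2 * π + θ₀) = p (x + θ₀)
    rw [show x + 2 * π + θ₀ = x + θ₀ + 2 * π by ring, hp.1]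
  have hPc : ∀ x, x ∉ lat → ContinuousAt (fun x => p (x + θ₀)) x := by
    intro x hx
    have h3 : ContinuousAt (fun y : ℝ => y + θ₀) x := by fun_prop
    refine ContinuousAt.comp (g := p) (hcont _ ?_) h3
    rintro ⟨n, hn⟩
    exact hx (mem_lat.2 ⟨n, by linarith⟩)
  have hc0 : Tendsto (fun y : ℝ => y + θ₀) (𝓝 0) (𝓝 θ₀) := by
    have : Continuous (fun y : ℝ => y + θ₀) := by fun_prop
    simpa using this.tendsto 0
  obtain ⟨⟨l1, h1⟩, ⟨l2, h2⟩⟩ := hp.2 θ₀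
  have hP1 : Tendsto (fun x => p (x + θ₀)) (𝓝[>] 0) (𝓝 l1) := by
    refine h1.comp (tendsto_nhdsWithin_of_tendsto_nhds_of_eventually_within _
      (hc0.mono_left nhdsWithin_le_nhds) ?_)
    filter_upwards [self_mem_nhdsWithin] with y hy
    have : 0 < y := hy
    simpa using this
  have hP2 : Tendsto (fun x => p (x + θ₀)) (𝓝[<] 0) (𝓝 l2) := by
    refine h2.comp (tendsto_nhdsWithin_of_tendsto_nhds_of_eventually_within _
      (hc0.mono_left nhdsWithin_le_nhds) ?_)
    filter_upwards [self_mem_nhdsWithin] with y hy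
    have : y < 0 := hy
    simpa using this
  obtain ⟨k1, k2⟩ := QC_iff.1 hq1
  have R1 := main0 hPper hPc hP1 hP2 k1 hl
  have hconj := Complex.continuous_conj
  have hl2 : Tendsto (PI (fun x => (starRingEnd ℂ) (q (x + θ₀)))) (𝓝[<] 1) (𝓝 0) := by
    have := (hconj.tendsto 0).comp hl
    rw [map_zero] at this
    refine this.congr fun r => ?_
    exact (PI_conj _).symm
  have R2 := main0 (p := fun x => (starRingEnd ℂ) (p (x + θ₀)))
    (fun x => congrArg (starRingEnd ℂ) (hPper x))
    (fun x hx => hconj.continuousAt.comp (hPc x hx))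
    ((hconj.tendsto l1).comp hP1) ((hconj.tendsto l2).comp hP2) k2 hl2
  have R : (fun x => p (x + θ₀) * q (x + θ₀)) ∈ QCset :=
    QC_iff.2 ⟨R1, by simpa only [map_mul] using R2⟩
  have R3 := QC_shift R (-θ₀)
  simp only [neg_add_cancel_right] at R3
  exact R3
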